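/- Let j ≥ 4 and let H = (h_0, …, h_j) be a symmetric sequence (h_i = h_{j−i}) of positive integers with h_0 = 1, h_1 = 4, h_2 = 7. Then the following are equivalent: (i) H is a Gorenstein sequence, i.e., the Hilbert function of some graded Artinian Gorenstein quotient of K[w,x,y,z]; (ii) ΔH_{≤ j/2} is an O-sequence; (iii) the sequence H' with h'_0 = 1, h'_i = h_i − 1 for 1 ≤ i ≤ j−1, h'_j = 1 is a height three Gorenstein sequence, i.e., the Hilbert function of some graded Artinian Gorenstein quotient of K[x,y,z]. -/

import Mathlib

open MvPolynomial

noncomputable section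

/-- The Hilbert function of the graded quotient `R/I`, where
`R = K[x_1,...,x_n]`: the dimension of the image in `R/I` of the space of
degree-`i` homogeneous forms. -/
def hilb (n : ℕ) (K : Type*) [Field K] (I : Ideal (MvPolynomial (Fin n) K)) (i : ℕ) : ℕ :=
  Module.finrank K
    ((homogeneousSubmodule (Fin n) K i).map (Ideal.Quotient.mkₐ K I).toLinearMap)

/-- The socle `(0 : A_+)` of `A = R/I`: the elements killed by (the images of)
all the variables, equivalently by the irrelevant maximal ideal. -/
def socleSub (n : ℕ) (K : Type*) [Field K] (I : Ideal (MvPolynomial (Fin n) K)) :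
    Submodule K (MvPolynomial (Fin n) K ⧸ I) :=
  ⨅ k : Fin n, LinearMap.ker (LinearMap.mulLeft K (Ideal.Quotient.mk I (X k)))

/-- A homogeneous (graded) ideal: one containing each homogeneous component of
each of its elements. -/
def IdealHomog {n : ℕ} {K : Type*} [Field K] (I : Ideal (MvPolynomial (Fin n) K)) : Prop :=
  ∀ f ∈ I, ∀ d : ℕ, homogeneousComponent d f ∈ I

/-- `R/I` is a graded Artinian Gorenstein quotient of `R = K[x_1,...,x_n]`
of socle degree `j`: `I` is homogeneous, `R/I` is finite dimensional over `K`
with 1-dimensional socle, and `j` is the top nonzero degree. -/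
def IsAG (n : ℕ) (K : Type*) [Field K] (I : Ideal (MvPolynomial (Fin n) K)) (j : ℕ) : Prop :=
  IdealHomog I ∧ FiniteDimensional K (MvPolynomial (Fin n) K ⧸ I) ∧
    Module.finrank K (socleSub n K I) = 1 ∧
    hilb n K I j ≠ 0 ∧ ∀ i, j < i → hilb n K I i = 0

/-- Macaulay's bound `c^{(d)}`: writing `c = C(k_d,d) + ... + C(k_1,1)` with
`k_d > k_d-1 > ... > k_1 ≥ 0` (the `d`-th Macaulay expansion, computed greedily),
`c^{(d)} = C(k_d+1,d+1) + ... + C(k_1+1,2)`; by convention `0^{(d)} = 0`. -/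
def macB : ℕ → ℕ → ℕ
  | _, 0 => 0
  | c, (d+1) =>
    if c = 0 then 0 else
      let k := Nat.findGreatest (fun k => Nat.choose k (d+1) ≤ c) (c + d + 1)
      Nat.choose (k+1) (d+2) + macB (c - Nat.choose k (d+1)) d

/-- `(t_0, ..., t_m)` is an O-sequence: `t_0 = 1` and `t_{i+1} ≤ t_i^{(i)}`
for `1 ≤ i ≤ m-1`. -/
def IsOSeq (t : ℕ → ℕ) (m : ℕ) : Prop :=
  t 0 = 1 ∧ ∀ i, 1 ≤ i → i + 1 ≤ m → t (i + 1) ≤ macB (t i) i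

/-- `ΔH_{≤ m}` is an O-sequence: the first differences `ΔH_i = h_i - h_{i-1}`
(with `ΔH_0 = 1`) are nonnegative for `i ≤ m`, and `(ΔH_0, ..., ΔH_m)` is an
O-sequence. -/
def DeltaOSeq (h : ℕ → ℕ) (m : ℕ) : Prop :=
  (∀ i, 1 ≤ i → i ≤ m → h (i - 1) ≤ h i) ∧
    IsOSeq (fun i => if i = 0 then 1 else h i - h (i - 1)) m

lemma macB_succ (c d : ℕ) (hc : c ≠ 0) : ∃ k, d + 1 ≤ k ∧ Nat.choose k (d+1) ≤ c ∧
    (c < Nat.choose (k+1) (d+1)) ∧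
    macB c (d+1) = Nat.choose (k+1) (d+2) + macB (c - Nat.choose k (d+1)) d := by
  refine ⟨Nat.findGreatest (fun k => Nat.choose k (d+1) ≤ c) (c + d + 1), ?_, ?_, ?_, ?_⟩
  · apply Nat.le_findGreatest
    · omega
    · simp; omega
  · exact Nat.findGreatest_spec (P := fun k => Nat.choose k (d+1) ≤ c) (m := 0) (by omega) (by simp)
  · set k := Nat.findGreatest (fun k => Nat.choose k (d+1) ≤ c) (c + d + 1) with hk
    by_contra hcon
    push Not at hcon
    by_cases hle : k + 1 ≤ c + d + 1
    · have := Nat.le_findGreatest (P := fun k => Nat.choose k (d+1) ≤ c) hle hcon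
      omega
    · have h1 : k = c + d + 1 := by
        have := Nat.findGreatest_le (P := fun k => Nat.choose k (d+1) ≤ c) (c + d + 1)
        omega
      have h2 : c + 1 ≤ Nat.choose (k+1) (d+1) := by
        rw [h1]
        have h3 : ∀ c d : ℕ, c + 1 ≤ Nat.choose (c + d + 1) (d + 1) := by
          intro c d
          induction c with
          | zero => simp
          | succ n ih =>
            have : n + 1 + d + 1 = (n + d + 1) + 1 := by ring
            rw [this, Nat.choose_succ_succ]
            have : 0 < (n + d + 1).choose d := Nat.choose_pos (by omega)
            change n + 1 + 1 ≤ (n + d + 1).choose d + (n + d + 1).choose (d + 1)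
            omega
        have := h3 (c+1) d
        have e : c + d + 1 + 1 = c + 1 + d + 1 := by ring
        rw [e]; omega
      omega
  · rw [macB]; simp [hc]

lemma le_macB : ∀ d c : ℕ, c ≤ macB c (d+1) := by
  intro d
  induction d with
  | zero =>
    intro c
    by_cases hc : c = 0
    · simp [hc]
    obtain ⟨k, h1, h2, h3, h4⟩ := macB_succ c 0 hc
    rw [h4]
    simp at h2 h3
    have : k = c := by omega
    subst this
    have : (k+1).choose 2 = k + k.choose 2 := by
      rw [Nat.choose_succ_succ]; simp
    simp [macB]; omega
  | succ d ih =>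
    intro c
    by_cases hc : c = 0
    · simp [hc]
    obtain ⟨k, h1, h2, h3, h4⟩ := macB_succ c (d+1) hc
    rw [h4]
    have := ih (c - k.choose (d+1+1))
    have h5 : (k+1).choose (d+1+2) = k.choose (d+1+1) + k.choose (d+1+2) := Nat.choose_succ_succ _ _
    omega

lemma macB_of_le : ∀ d c : ℕ, c ≤ d → macB c d = c := by
  intro d
  induction d with
  | zero => intro c hc; simp [macB]; omega
  | succ d ih =>
    intro c hc
    by_cases h0 : c = 0
    · simp [h0, macB]
    obtain ⟨k, h1, h2, h3, h4⟩ := macB_succ c d h0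
    have : k = d + 1 := by
      by_contra hne
      have : (d+2).choose (d+1) ≤ k.choose (d+1) := Nat.choose_le_choose _ (by omega)
      simp at this
      omega
    subst this
    rw [h4]
    simp
    rw [ih (c-1) (by omega)]
    omega

lemma macB_full (d : ℕ) : macB (d+2) (d+1) = d + 3 := by
  obtain ⟨k, h1, h2, h3, h4⟩ := macB_succ (d+2) d (by omega)
  have : d + 2 ≤ k := by
    by_contra hne
    have : k = d + 1 := by omega
    subst this
    simp at h3
  have e : d + 2 = d + 1 + 1 := rfl
  have hk : k = d + 2 ∨ d + 3 ≤ k := by omega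
  rcases hk with rfl | hk
  · rw [h4]
    have : (d+2).choose (d+1) = d + 2 := by simp
    rw [this]
    have : (d+2+1).choose (d+2) = d + 3 := by simp
    rw [this]
    simp
    cases d <;> simp [macB]
  · exfalso
    have : (d+3).choose (d+1) ≤ k.choose (d+1) := Nat.choose_le_choose _ (by omega)
    have h6 : (d+3).choose (d+1) = (d+2).choose d + (d+2).choose (d+1) := Nat.choose_succ_succ _ _
    have : 0 < (d+2).choose d := Nat.choose_pos (by omega)
    have : (d+2).choose (d+1) = d + 2 := by simp
    omega

/-- The purely numerical heart of (i) ⇒ (ii). -/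
lemma deltaOSeq_of_ranks (j : ℕ) (h r : ℕ → ℕ) (t : ℕ) (ht : 3 ≤ t)
    (hsym : ∀ i ≤ j, h (j - i) = h i)
    (h0 : h 0 = 1) (h1 : h 1 = 3 ∨ h 1 = 4)
    (hr : ∀ i, 1 ≤ i → i ≤ j → r i = r (j + 1 - i))
    (hfull : ∀ i, 2 ≤ i → i < t → h i = h (i - 1) + (i + 1))
    (hdec : ∀ d, t ≤ d + 1 → h (d + 1) + r d ≤ h d + r (d + 1)) :
    DeltaOSeq h (j / 2) := by
  have hmono : ∀ n d, t ≤ d + 1 → h (d + n) + r d ≤ h d + r (d + n) := by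
    intro n
    induction n with
    | zero => intro d _; simp
    | succ n ih =>
      intro d hd
      have a := ih d hd
      have b := hdec (d+n) (by omega)
      have e : d + (n+1) = d + n + 1 := by ring
      rw [e]; omega
  have key : ∀ i, t ≤ i + 1 → 1 ≤ i → i ≤ j / 2 → h (i-1) ≤ h i := by
    intro i hi h1i hij
    have a := hmono (j + 1 - i - i) i hi
    have e : i + (j + 1 - i - i) = j + 1 - i := by omega
    rw [e] at a
    have b := hr i h1i (by omega)
    have c := hsym (i-1) (by omega)
    have e2 : j - (i-1) = j + 1 - i := by omega
    rw [e2] at c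
    omega
  have hnn : ∀ i, 1 ≤ i → i ≤ j / 2 → h (i-1) ≤ h i := by
    intro i hi1 hi2
    by_cases c1 : i = 1
    · subst c1; simp [h0]; omega
    by_cases c2 : i < t
    · have := hfull i (by omega) c2; omega
    · exact key i (by omega) hi1 hi2
  refine ⟨hnn, by simp, ?_⟩
  intro i hi1 hi2
  have e0 : i ≠ 0 := by omega
  simp only [e0, if_false, Nat.succ_ne_zero, Nat.add_sub_cancel]
  have hi1' : i = (i - 1) + 1 := by omega
  by_cases c1 : i = 1
  · subst c1
    have := hfull 2 (by omega) (by omega)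
    simp [h0] at this ⊢
    have e : 3 ≤ macB 3 1 := le_macB 0 3
    have e' := macB_full 0
    rcases h1 with h1 | h1
    · rw [h1] at this ⊢
      simp at e' ⊢
      omega
    · rw [h1] at this ⊢
      simp
      omega
  by_cases c2 : i + 1 < t
  · have a := hfull (i+1) (by omega) c2
    have b := hfull i (by omega) (by omega)
    have e1 : h (i+1) - h i = i + 2 := by simp at a; omega
    have e2 : h i - h (i-1) = i + 1 := by omega
    rw [e1, e2]
    have := macB_full (i-1)
    have e3 : i - 1 + 2 = i + 1 := by omega
    have e4 : i - 1 + 1 = i := by omega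
    rw [e3, e4] at this
    omega
  · have a := hdec i (by omega)
    have b := hdec (j - i) (by omega)
    have s1 := hsym i (by omega)
    have s2 := hsym (i-1) (by omega)
    have e2 : j - (i-1) = j - i + 1 := by omega
    rw [e2] at s2
    have r1 := hr i hi1 (by omega)
    have r2 := hr (i+1) (by omega) (by omega)
    have e3 : j + 1 - i = j - i + 1 := by omega
    have e4 : j + 1 - (i + 1) = j - i := by omega
    rw [e3] at r1
    rw [e4] at r2
    have n1 := hnn i hi1 (by omega)
    have n2 := hnn (i+1) (by omega) (by omega)
    simp at n2
    have fin : h (i+1) - h i ≤ h i - h (i-1) := by omega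
    have := le_macB (i-1) (h i - h (i-1))
    rw [← hi1'] at this
    omega

/-- What (ii) says concretely. -/
lemma shape_of_deltaOSeq (m : ℕ) (h : ℕ → ℕ) (h0 : h 0 = 1) (h1 : h 1 = 4) (h2 : h 2 = 7)
    (H : DeltaOSeq h m) :
    ∃ δ : ℕ → ℕ, δ 0 = 1 ∧ δ 1 = 2 ∧ (∀ i, 2 ≤ i → i ≤ m → h i = h (i-1) + δ i) ∧
      (∀ i ≤ m, δ i ≤ i + 1) ∧
      (∀ i, i + 1 ≤ m → δ (i+1) ≤ δ i ∨ (δ i = i + 1 ∧ δ (i+1) ≤ i + 2)) := by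
  obtain ⟨hnn, -, hO⟩ := H
  let δ : ℕ → ℕ := fun i => if i = 0 then 1 else if i = 1 then 2 else h i - h (i-1)
  have hδ : ∀ i, 2 ≤ i → δ i = h i - h (i-1) := by
    intro i hi
    have : i ≠ 0 := by omega
    have : i ≠ 1 := by omega
    simp [δ, *]
  have hstep : ∀ i, 2 ≤ i → i + 1 ≤ m → δ (i+1) ≤ macB (δ i) i := by
    intro i hi him
    have := hO i (by omega) him
    have e0 : i ≠ 0 := by omega
    simp only [e0, if_false, Nat.succ_ne_zero, Nat.add_sub_cancel] at this
    rw [hδ (i+1) (by omega), hδ i hi]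
    exact this
  have hb : ∀ i ≤ m, δ i ≤ i + 1 := by
    intro i
    induction i with
    | zero => intro _; simp [δ]
    | succ i ih =>
      intro him
      by_cases c0 : i = 0
      · subst c0; simp [δ]
      by_cases c1 : i = 1
      · subst c1; simp [δ, h1, h2]
      have a := hstep i (by omega) him
      have b := ih (by omega)
      by_cases c : δ i ≤ i
      · rw [macB_of_le _ _ c] at a; omega
      · have e : δ i = i + 1 := by omega
        have := macB_full (i-1)
        have e3 : i - 1 + 2 = i + 1 := by omega
        have e4 : i - 1 + 1 = i := by omega
        rw [e3, e4] at this
        rw [e, this] at a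
        omega
  refine ⟨δ, by simp [δ], by simp [δ], ?_, hb, ?_⟩
  · intro i hi him
    rw [hδ i hi]
    have := hnn i (by omega) him
    omega
  · intro i him
    have a := hb (i+1) him
    have b := hb i (by omega)
    by_cases c : δ i ≤ i
    · left
      by_cases c0 : i = 0
      · subst c0; simp [δ] at c
      by_cases c1 : i = 1
      · subst c1; simp [δ] at c
      have a := hstep i (by omega) him
      rwa [macB_of_le _ _ c] at a
    · right; omega


lemma finrank_map_congr {K V M N : Type*} [Field K] [AddCommGroup V] [Module K V]
    [AddCommGroup M] [Module K M] [AddCommGroup N] [Module K N] (W : Submodule K V)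
    (f : V →ₗ[K] M) (g : V →ₗ[K] N) (hfg : ∀ x ∈ W, f x = 0 ↔ g x = 0) :
    Module.finrank K (W.map f) = Module.finrank K (W.map g) := by
  have e1 : W.map f = LinearMap.range (f.domRestrict W) := by
    ext x; simp [Submodule.mem_map]
  have e2 : W.map g = LinearMap.range (g.domRestrict W) := by
    ext x; simp [Submodule.mem_map]
  have hk : LinearMap.ker (f.domRestrict W) = LinearMap.ker (g.domRestrict W) := by
    ext ⟨x, hx⟩; simpa using hfg x hx
  rw [e1, e2]
  exact LinearEquiv.finrank_eq (((f.domRestrict W).quotKerEquivRange.symm.trans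
    (Submodule.quotEquivOfEq _ _ hk)).trans (g.domRestrict W).quotKerEquivRange)

/-- The ideal of all `g` with `φ (g * R) = 0`. -/
def gorIdeal {n : ℕ} {K : Type*} [Field K] (φ : MvPolynomial (Fin n) K →ₗ[K] K) :
    Ideal (MvPolynomial (Fin n) K) where
  carrier := {g | ∀ q, φ (g * q) = 0}
  add_mem' := by
    intro a b ha hb q
    rw [add_mul, map_add, ha, hb, add_zero]
  zero_mem' := by intro q; simp
  smul_mem' := by
    intro c x hx q
    have : c • x * q = x * (c * q) := by simp [smul_eq_mul]; ring
    rw [this]; exact hx _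

lemma mem_gorIdeal {n : ℕ} {K : Type*} [Field K] (φ : MvPolynomial (Fin n) K →ₗ[K] K)
    (g : MvPolynomial (Fin n) K) : g ∈ gorIdeal φ ↔ ∀ q, φ (g * q) = 0 := Iff.rfl

section gor
variable {n : ℕ} {K : Type*} [Field K] (φ : MvPolynomial (Fin n) K →ₗ[K] K) (j : ℕ)

lemma comp_ext (p q : MvPolynomial (Fin n) K)
    (h : ∀ d, φ (p * homogeneousComponent d q) = 0) : φ (p * q) = 0 := by
  rw [← sum_homogeneousComponent q, Finset.mul_sum, map_sum]
  exact Finset.sum_eq_zero fun d _ => h d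

lemma mem_gorIdeal_homog (hφ : ∀ d, d ≠ j → ∀ g ∈ homogeneousSubmodule (Fin n) K d, φ g = 0)
    {i : ℕ} (hi : i ≤ j) {g : MvPolynomial (Fin n) K} (hg : g ∈ homogeneousSubmodule (Fin n) K i) :
    g ∈ gorIdeal φ ↔ ∀ q ∈ homogeneousSubmodule (Fin n) K (j - i), φ (g * q) = 0 := by
  rw [mem_gorIdeal]
  refine ⟨fun h q _ => h q, fun h q => comp_ext φ g q fun d => ?_⟩
  by_cases hd : i + d = j
  · have : d = j - i := by omega
    subst this
    exact h _ (homogeneousComponent_mem _ _)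
  · exact hφ (i + d) hd _ (IsHomogeneous.mul hg (homogeneousComponent_isHomogeneous d q))

lemma mem_gorIdeal_of_lt (hφ : ∀ d, d ≠ j → ∀ g ∈ homogeneousSubmodule (Fin n) K d, φ g = 0)
    {i : ℕ} (hi : j < i) {g : MvPolynomial (Fin n) K} (hg : g ∈ homogeneousSubmodule (Fin n) K i) :
    g ∈ gorIdeal φ := by
  intro q
  refine comp_ext φ g q fun d => ?_
  exact hφ (i + d) (by omega) _ (IsHomogeneous.mul hg (homogeneousComponent_isHomogeneous d q))

lemma mem_gorIdeal_iff_comp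
    (hφ : ∀ d, d ≠ j → ∀ g ∈ homogeneousSubmodule (Fin n) K d, φ g = 0)
    (g : MvPolynomial (Fin n) K) :
    g ∈ gorIdeal φ ↔ ∀ d ≤ j, ∀ q ∈ homogeneousSubmodule (Fin n) K d, φ (g * q) = 0 := by
  refine ⟨fun h d _ q _ => h q, fun h q => comp_ext φ g q fun d => ?_⟩
  by_cases hd : d ≤ j
  · exact h d hd _ (homogeneousComponent_mem _ _)
  · rw [mul_comm]
    exact mem_gorIdeal_of_lt φ j hφ (by omega) (homogeneousComponent_mem d q) g

theorem gorIdeal_isAG (hφ : ∀ d, d ≠ j → ∀ g ∈ homogeneousSubmodule (Fin n) K d, φ g = 0)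
    (hne : ∃ g ∈ homogeneousSubmodule (Fin n) K j, φ g ≠ 0) : IsAG n K (gorIdeal φ) j := by
  obtain ⟨g0, hg0, hφ0⟩ := hne
  have hnotin : g0 ∉ gorIdeal φ := fun h => hφ0 (by simpa using h 1)
  refine ⟨?_, ?_, ?_, ?_, ?_⟩
  · intro f hf d
    by_cases hd : d ≤ j
    · rw [mem_gorIdeal_homog φ j hφ hd (homogeneousComponent_mem _ _)]
      intro q hq
      have h1 : φ (f * q) = 0 := hf q
      rw [← sum_homogeneousComponent f, Finset.sum_mul, map_sum] at h1
      by_cases hdt : d ∈ Finset.range (f.totalDegree + 1)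
      · rw [Finset.sum_eq_single_of_mem d hdt] at h1
        · exact h1
        · intro b _ hb
          exact hφ (b + (j - d)) (by omega) _
            (IsHomogeneous.mul (homogeneousComponent_isHomogeneous b f) hq)
      · have : homogeneousComponent d f = 0 := by
          apply homogeneousComponent_eq_zero
          simp at hdt; omega
        simp [this]
    · exact mem_gorIdeal_of_lt φ j hφ (by omega) (homogeneousComponent_mem _ _)
  · let T : MvPolynomial (Fin n) K →ₗ[K]
        ((d : Fin (j+1)) → Module.Dual K (homogeneousSubmodule (Fin n) K (d : ℕ))) :=
      LinearMap.pi fun d =>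
        { toFun := fun g => (φ ∘ₗ LinearMap.mulLeft K g).domRestrict _
          map_add' := by intro a b; ext x; simp [add_mul]
          map_smul' := by intro a b; ext x; simp }
    have hfd : ∀ d : ℕ, Module.Finite K (homogeneousSubmodule (Fin n) K d) := fun d =>
      Module.Finite.iff_fg.mpr (homogeneousSubmodule_fg _ _ d)
    have hker : LinearMap.ker T = (gorIdeal φ).restrictScalars K := by
      ext g
      rw [LinearMap.mem_ker, Submodule.restrictScalars_mem, mem_gorIdeal_iff_comp φ j hφ]
      constructor
      · intro h d hd q hq
        have := congrFun h ⟨d, by omega⟩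
        exact LinearMap.congr_fun this ⟨q, hq⟩
      · intro h
        funext d
        ext ⟨q, hq⟩
        exact h d (by omega) q hq
    have e : (MvPolynomial (Fin n) K ⧸ (gorIdeal φ).restrictScalars K) ≃ₗ[K] LinearMap.range T :=
      (Submodule.quotEquivOfEq _ _ hker.symm).trans T.quotKerEquivRange
    have hF : FiniteDimensional K (MvPolynomial (Fin n) K ⧸ (gorIdeal φ).restrictScalars K) :=
      Module.Finite.equiv e.symm
    exact hF
  · let φ' : (MvPolynomial (Fin n) K ⧸ gorIdeal φ) →ₗ[K] K :=
      ((gorIdeal φ).restrictScalars K).liftQ φ (by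
        intro x hx
        have := hx 1
        simpa using this)
    have hφ' : ∀ g, φ' (Ideal.Quotient.mk _ g) = φ g := fun g => rfl
    have hsoc : ∀ g, Ideal.Quotient.mk (gorIdeal φ) g ∈ socleSub n K (gorIdeal φ) ↔
        ∀ k, X k * g ∈ gorIdeal φ := by
      intro g
      simp only [socleSub, Submodule.mem_iInf, LinearMap.mem_ker, LinearMap.mulLeft_apply,
        ← map_mul, Ideal.Quotient.eq_zero_iff_mem]
    have hg0s : Ideal.Quotient.mk (gorIdeal φ) g0 ∈ socleSub n K (gorIdeal φ) := by
      rw [hsoc]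
      intro k
      exact mem_gorIdeal_of_lt φ j hφ (i := 1 + j) (by omega)
        (IsHomogeneous.mul (isHomogeneous_X K k) hg0)
    have hkill : ∀ g, (∀ k, X k * g ∈ gorIdeal φ) → φ g = 0 → g ∈ gorIdeal φ := by
      intro g hX h0 q
      induction q using MvPolynomial.induction_on with
      | C a =>
        have : g * C a = a • g := by rw [MvPolynomial.smul_eq_C_mul, mul_comm]
        rw [this, map_smul, h0, smul_zero]
      | add p q hp hq => rw [mul_add, map_add, hp, hq, add_zero]
      | mul_X p k _ =>
        have : g * (p * X k) = X k * g * p := by ring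
        rw [this]
        exact hX k p
    rw [finrank_eq_one_iff_of_nonzero' (⟨_, hg0s⟩ : socleSub n K (gorIdeal φ))]
    · rintro ⟨w, hw⟩
      obtain ⟨g, rfl⟩ := Ideal.Quotient.mk_surjective w
      refine ⟨φ g / φ g0, ?_⟩
      apply Subtype.ext
      change (φ g / φ g0) • Ideal.Quotient.mk (gorIdeal φ) g0 = Ideal.Quotient.mk (gorIdeal φ) g
      have : (φ g / φ g0) • Ideal.Quotient.mk (gorIdeal φ) g0
        = Ideal.Quotient.mk (gorIdeal φ) ((φ g / φ g0) • g0) := rfl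
      rw [this, Ideal.Quotient.eq]
      apply hkill
      · intro k
        rw [hsoc] at hw hg0s
        have e : X k * ((φ g / φ g0) • g0 - g) = C (φ g / φ g0) * (X k * g0) - X k * g := by
          rw [MvPolynomial.smul_eq_C_mul]; ring
        rw [e]
        exact Ideal.sub_mem _ (Ideal.mul_mem_left _ _ (hg0s k)) (hw k)
      · rw [map_sub, map_smul, smul_eq_mul, div_mul_cancel₀ _ hφ0, sub_self]
    · intro h
      apply hnotin
      rw [← Ideal.Quotient.eq_zero_iff_mem]
      exact congrArg Subtype.val h
  · intro h
    have hfd : Module.Finite K (homogeneousSubmodule (Fin n) K j) :=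
      Module.Finite.iff_fg.mpr (homogeneousSubmodule_fg _ _ j)
    unfold hilb at h
    rw [Submodule.finrank_eq_zero] at h
    apply hnotin
    rw [← Ideal.Quotient.eq_zero_iff_mem]
    have : (Ideal.Quotient.mkₐ K (gorIdeal φ)).toLinearMap g0 ∈
      (homogeneousSubmodule (Fin n) K j).map (Ideal.Quotient.mkₐ K (gorIdeal φ)).toLinearMap :=
      Submodule.mem_map_of_mem hg0
    rw [h] at this
    simpa using this
  · intro i hi
    unfold hilb
    have : (homogeneousSubmodule (Fin n) K i).map (Ideal.Quotient.mkₐ K (gorIdeal φ)).toLinearMap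
      = ⊥ := by
      rw [eq_bot_iff]
      rintro _ ⟨g, hg, rfl⟩
      have := mem_gorIdeal_of_lt φ j hφ hi hg
      rw [← Ideal.Quotient.eq_zero_iff_mem] at this
      simpa using this
    rw [this]; simp

end gor

/-- Evaluation at a finite family of points. -/
def evPts {n : ℕ} {K : Type*} [Field K] {ι : Type*} (z : ι → Fin n → K) :
    MvPolynomial (Fin n) K →ₗ[K] (ι → K) :=
  LinearMap.pi fun a => (MvPolynomial.aeval (z a)).toLinearMap

lemma evPts_apply {n : ℕ} {K : Type*} [Field K] {ι : Type*} (z : ι → Fin n → K)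
    (g : MvPolynomial (Fin n) K) (a : ι) : evPts z g a = eval (z a) g := by
  simp [evPts, MvPolynomial.aeval_eq_eval]

/-- The space of values of degree `i` forms at a family of points. -/
def evDeg {n : ℕ} {K : Type*} [Field K] {ι : Type*} (z : ι → Fin n → K) (i : ℕ) :
    Submodule K (ι → K) :=
  (homogeneousSubmodule (Fin n) K i).map (evPts z)

theorem points_AG {n : ℕ} {K : Type*} [Field K] {ι : Type*} [Fintype ι] [Nonempty ι]
    (z : ι → Fin n → K) (j : ℕ) (htop : evDeg z j = ⊤) :
    ∃ I : Ideal (MvPolynomial (Fin n) K), IsAG n K I j ∧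
      (∀ i ≤ j, evDeg z (j - i) = ⊤ → hilb n K I i = Module.finrank K (evDeg z i)) ∧
      (∀ i ≤ j, evDeg z i = ⊤ → hilb n K I i = Module.finrank K (evDeg z (j - i))) := by
  classical
  let φ : MvPolynomial (Fin n) K →ₗ[K] K :=
    (∑ a : ι, LinearMap.proj a) ∘ₗ evPts z ∘ₗ homogeneousComponent j
  have hφj : ∀ g ∈ homogeneousSubmodule (Fin n) K j, φ g = ∑ a, evPts z g a := by
    intro g hg
    simp [φ, homogeneousComponent_eq_self hg]
  have hφ : ∀ d, d ≠ j → ∀ g ∈ homogeneousSubmodule (Fin n) K d, φ g = 0 := by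
    intro d hd g hg
    have : homogeneousComponent j g = 0 := by
      rw [homogeneousComponent_of_mem hg, if_neg (Ne.symm hd)]
    simp [φ, this]
  have hmul : ∀ i ≤ j, ∀ g ∈ homogeneousSubmodule (Fin n) K i,
      ∀ q ∈ homogeneousSubmodule (Fin n) K (j - i),
      φ (g * q) = ∑ a, evPts z g a * evPts z q a := by
    intro i hi g hg q hq
    have hm : g * q ∈ homogeneousSubmodule (Fin n) K j := by
      have := IsHomogeneous.mul hg hq
      rwa [Nat.add_sub_cancel' hi] at this
    rw [hφj _ hm]
    simp [evPts_apply]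
  have hmem : ∀ i ≤ j, ∀ g ∈ homogeneousSubmodule (Fin n) K i,
      g ∈ gorIdeal φ ↔ ∀ v ∈ evDeg z (j - i), ∑ a, evPts z g a * v a = 0 := by
    intro i hi g hg
    rw [mem_gorIdeal_homog φ j hφ hi hg]
    constructor
    · rintro h _ ⟨q, hq, rfl⟩
      rw [← hmul i hi g hg q hq]; exact h q hq
    · intro h q hq
      rw [hmul i hi g hg q hq]
      exact h _ (Submodule.mem_map_of_mem hq)
  refine ⟨gorIdeal φ, gorIdeal_isAG φ j hφ ?_, ?_, ?_⟩
  · obtain ⟨a⟩ := ‹Nonempty ι›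
    have : (Pi.single a 1 : ι → K) ∈ evDeg z j := by rw [htop]; trivial
    obtain ⟨g, hg, hga⟩ := this
    refine ⟨g, hg, ?_⟩
    rw [hφj g hg, hga]
    simp
  · intro i hi ht
    unfold hilb evDeg
    apply finrank_map_congr
    intro g hg
    have : (Ideal.Quotient.mkₐ K (gorIdeal φ)).toLinearMap g = 0 ↔ g ∈ gorIdeal φ := by
      rw [← Ideal.Quotient.eq_zero_iff_mem]; rfl
    rw [this, hmem i hi g hg, ht]
    constructor
    · intro h
      funext a
      have := h (Pi.single a 1) trivial
      simpa [Pi.single_apply] using this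
    · intro h v _
      simp [h]
  · intro i hi ht
    let B : (ι → K) →ₗ[K] Module.Dual K (evDeg z (j - i)) :=
      { toFun := fun u => (∑ a, u a • (LinearMap.proj a : (ι → K) →ₗ[K] K)).domRestrict _
        map_add' := by intro u v; ext x; simp [add_mul, Finset.sum_add_distrib]
        map_smul' := by intro c v; ext x; simp [Finset.mul_sum, mul_assoc] }
    have hB : Function.Surjective B := by
      intro f
      obtain ⟨F, hF⟩ := f.exists_extend
      refine ⟨fun a => F (Pi.single a 1), ?_⟩
      ext ⟨v, hv⟩
      have h1 : f ⟨v, hv⟩ = F v := by rw [← hF]; rfl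
      rw [h1]
      conv_rhs => rw [← Finset.univ_sum_single v, map_sum]
      simp only [B, LinearMap.coe_mk, AddHom.coe_mk, LinearMap.domRestrict_apply,
        LinearMap.sum_apply, LinearMap.smul_apply, LinearMap.proj_apply, smul_eq_mul]
      refine Finset.sum_congr rfl fun a _ => ?_
      have : (Pi.single a (v a) : ι → K) = v a • Pi.single a 1 := by
        rw [← Pi.single_smul]; simp
      rw [this, map_smul, smul_eq_mul, mul_comm]
    have h1 : hilb n K (gorIdeal φ) i =
        Module.finrank K ((homogeneousSubmodule (Fin n) K i).map (B ∘ₗ evPts z)) := by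
      unfold hilb
      apply finrank_map_congr
      intro g hg
      have : (Ideal.Quotient.mkₐ K (gorIdeal φ)).toLinearMap g = 0 ↔ g ∈ gorIdeal φ := by
        rw [← Ideal.Quotient.eq_zero_iff_mem]; rfl
      rw [this, hmem i hi g hg]
      constructor
      · intro h
        ext ⟨v, hv⟩
        simpa [B] using h v hv
      · intro h v hv
        have := LinearMap.congr_fun h ⟨v, hv⟩
        simpa [B] using this
    rw [h1, Submodule.map_comp]
    change Module.finrank K (Submodule.map B (evDeg z i)) = _
    rw [ht, Submodule.map_top, LinearMap.range_eq_top.mpr hB, finrank_top, Subspace.dual_finrank_eq]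


/-- Product of two falling factorials. -/
def ffv (K : Type*) [Field K] (a b : ℕ) (x y : ℕ) : K :=
  (∏ k ∈ Finset.range a, ((x : K) - (k : K))) * ∏ k ∈ Finset.range b, ((y : K) - (k : K))

lemma ffv_eq_zero (K : Type*) [Field K] [CharZero K] (a b x y : ℕ) :
    ffv K a b x y = 0 ↔ ¬ (a ≤ x ∧ b ≤ y) := by
  have key : ∀ a x : ℕ, (∏ k ∈ Finset.range a, ((x : K) - (k : K))) = 0 ↔ x < a := by
    intro a x
    rw [Finset.prod_eq_zero_iff]
    constructor
    · rintro ⟨k, hk, h⟩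
      rw [sub_eq_zero, Nat.cast_inj] at h
      subst h; simpa using hk
    · intro h
      exact ⟨x, by simpa using h, by simp⟩
  rw [ffv, mul_eq_zero, key, key]
  omega

/-- Index set: `⟨k, a⟩` with `k ≤ m`, `a < δ k`, standing for the point `(a, k - a)`. -/
def idx (δ : ℕ → ℕ) (m : ℕ) : Finset (Σ _ : ℕ, ℕ) :=
  (Finset.range (m+1)).sigma fun k => Finset.range (δ k)

lemma mem_idx (δ : ℕ → ℕ) (m : ℕ) (c : Σ _ : ℕ, ℕ) : c ∈ idx δ m ↔ c.1 ≤ m ∧ c.2 < δ c.1 := by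
  simp [idx, Nat.lt_succ_iff]

lemma card_idx (δ : ℕ → ℕ) (m : ℕ) : (idx δ m).card = ∑ k ∈ Finset.range (m+1), δ k := by
  simp [idx, Finset.card_sigma]

section pts
variable (K : Type*) [Field K] [CharZero K] (δ : ℕ → ℕ) (m : ℕ)

/-- The vector of values of `ffv a b`. -/
def vv (a b : ℕ) : (idx δ m → K) := fun c => ffv K a b c.1.2 (c.1.1 - c.1.2)

/-- The points. -/
def zz : idx δ m → Fin 3 → K := fun c => ![1, (c.1.2 : K), ((c.1.1 - c.1.2 : ℕ) : K)]

/-- Span of values of degree at most `i`. -/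
def SS (i : ℕ) : Submodule K (idx δ m → K) :=
  Submodule.span K {v | ∃ a b, a + b ≤ i ∧ v = vv K δ m a b}

variable {δ m}

lemma down
    (hs : ∀ i, i + 1 ≤ m → δ (i+1) ≤ δ i ∨ (δ i = i + 1 ∧ δ (i+1) ≤ i + 2)) (a b : ℕ) : ∀ x y, (x + y ≤ m ∧ x < δ (x + y)) → a ≤ x → b ≤ y →
    (a + b ≤ m ∧ a < δ (a + b)) := by
  have s1 : ∀ x y, (x + 1 + y ≤ m ∧ x + 1 < δ (x + 1 + y)) → (x + y ≤ m ∧ x < δ (x + y)) := by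
    rintro x y ⟨h1, h2⟩
    have e : x + 1 + y = x + y + 1 := by ring
    rw [e] at h1 h2
    have := hs _ h1
    omega
  have s2 : ∀ x y, (x + (y + 1) ≤ m ∧ x < δ (x + (y + 1))) → (x + y ≤ m ∧ x < δ (x + y)) := by
    rintro x y ⟨h1, h2⟩
    have e : x + (y + 1) = x + y + 1 := by ring
    rw [e] at h1 h2
    have := hs _ h1
    omega
  have t1 : ∀ n x y, (x + n + y ≤ m ∧ x + n < δ (x + n + y)) → (x + y ≤ m ∧ x < δ (x + y)) := by
    intro n
    induction n with
    | zero => intro x y h; simpa using h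
    | succ n ih => intro x y h; exact ih x y (s1 (x+n) y h)
  have t2 : ∀ n x y, (x + (y + n) ≤ m ∧ x < δ (x + (y + n))) → (x + y ≤ m ∧ x < δ (x + y)) := by
    intro n
    induction n with
    | zero => intro x y h; simpa using h
    | succ n ih => intro x y h; exact ih x y (s2 x (y+n) h)
  intro x y h hax hby
  obtain ⟨p, rfl⟩ := Nat.exists_eq_add_of_le hax
  obtain ⟨q, rfl⟩ := Nat.exists_eq_add_of_le hby
  exact t2 q a b (t1 p a (b + q) h)

lemma vv_eq_zero (hb : ∀ i ≤ m, δ i ≤ i + 1)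
    (hs : ∀ i, i + 1 ≤ m → δ (i+1) ≤ δ i ∨ (δ i = i + 1 ∧ δ (i+1) ≤ i + 2)) (a b : ℕ) (h : ¬ (a + b ≤ m ∧ a < δ (a + b))) : vv K δ m a b = 0 := by
  funext c
  obtain ⟨⟨k, x⟩, hc⟩ := c
  rw [mem_idx] at hc
  simp only [vv, Pi.zero_apply]
  rw [ffv_eq_zero]
  rintro ⟨h1, h2⟩
  simp only at hc h1 h2
  have := hb k hc.1
  apply h
  have e : x + (k - x) = k := by omega
  exact down hs a b x (k - x) (by rw [e]; exact hc) h1 h2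

lemma SS_mono (i : ℕ) : SS K δ m i ≤ SS K δ m (i+1) := by
  apply Submodule.span_mono
  rintro v ⟨a, b, h, rfl⟩
  exact ⟨a, b, by omega, rfl⟩

lemma SS_mul (i : ℕ) (k : Fin 3) (v : idx δ m → K) (hv : v ∈ SS K δ m i) :
    (fun c => v c * zz K δ m c k) ∈ SS K δ m (i+1) := by
  let T : (idx δ m → K) →ₗ[K] (idx δ m → K) :=
    { toFun := fun v c => v c * zz K δ m c k
      map_add' := by intro u v; funext c; simp [add_mul]
      map_smul' := by intro u v; funext c; simp [mul_assoc] }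
  change T v ∈ SS K δ m (i+1)
  suffices h : SS K δ m i ≤ (SS K δ m (i+1)).comap T from h hv
  unfold SS
  rw [Submodule.span_le]
  rintro _ ⟨a, b, hab, rfl⟩
  change T (vv K δ m a b) ∈ SS K δ m (i+1)
  have mem : ∀ a b, a + b ≤ i + 1 → vv K δ m a b ∈ SS K δ m (i+1) := fun a b h =>
    Submodule.subset_span ⟨a, b, h, rfl⟩
  fin_cases k
  · have : T (vv K δ m a b) = vv K δ m a b := by
      funext c; simp [T, zz]
    change T (vv K δ m a b) ∈ _
    rw [this]; exact mem a b (by omega)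
  · have : T (vv K δ m a b) = vv K δ m (a+1) b + (a : K) • vv K δ m a b := by
      funext c; simp [T, zz, vv, ffv, Finset.prod_range_succ]; ring
    change T (vv K δ m a b) ∈ _
    rw [this]
    exact add_mem (mem _ _ (by omega)) (Submodule.smul_mem _ _ (mem _ _ (by omega)))
  · have : T (vv K δ m a b) = vv K δ m a (b+1) + (b : K) • vv K δ m a b := by
      funext c; simp [T, zz, vv, ffv, Finset.prod_range_succ]; ring
    change T (vv K δ m a b) ∈ _
    rw [this]
    exact add_mem (mem _ _ (by omega)) (Submodule.smul_mem _ _ (mem _ _ (by omega)))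

lemma evDeg_zz (i : ℕ) : evDeg (zz K δ m) i = SS K δ m i := by
  apply le_antisymm
  · rintro _ ⟨g, hg, rfl⟩
    induction i generalizing g with
    | zero =>
      have : g = C (coeff 0 g) := by
        rw [← totalDegree_eq_zero_iff_eq_C]
        have := IsHomogeneous.totalDegree_le hg
        omega
      have h2 : evPts (zz K δ m) g = (coeff 0 g) • vv K δ m 0 0 := by
        funext c
        rw [evPts_apply]
        conv_lhs => rw [this]
        simp [vv, ffv]
      rw [h2]
      exact Submodule.smul_mem _ _ (Submodule.subset_span ⟨0, 0, by omega, rfl⟩)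
    | succ i ih =>
      have hg' : g ∈ (homogeneousSubmodule (Fin 3) K i) * (homogeneousSubmodule (Fin 3) K 1) := by
        rw [← homogeneousSubmodule_one_pow, ← pow_succ, homogeneousSubmodule_one_pow]; exact hg
      clear hg
      refine Submodule.mul_induction_on hg' ?_ ?_
      · intro p hp q hq
        rw [homogeneousSubmodule_one_eq_span_X] at hq
        induction hq using Submodule.span_induction with
        | mem x hx =>
          obtain ⟨k, rfl⟩ := hx
          have := SS_mul K i k _ (ih p hp)
          convert this using 1
          funext c
          simp [evPts_apply]
        | zero => simp
        | add x y _ _ hx hy => rw [mul_add, map_add]; exact add_mem hx hy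
        | smul a x _ hx => rw [mul_smul_comm, map_smul]; exact Submodule.smul_mem _ _ hx
      · intro x y hx hy
        rw [map_add]; exact add_mem hx hy
  · unfold SS
    rw [Submodule.span_le]
    rintro _ ⟨a, b, hab, rfl⟩
    refine ⟨X 0 ^ (i - a - b) * ((∏ k ∈ Finset.range a, (X 1 - C (k : K) * X 0)) *
      ∏ k ∈ Finset.range b, (X 2 - C (k : K) * X 0)), ?_, ?_⟩
    · have hp : ∀ (s : Fin 3) (a : ℕ),
          (∏ k ∈ Finset.range a, (X s - C (k : K) * X 0 : MvPolynomial (Fin 3) K)).IsHomogeneous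
            a := by
        intro s a
        have := IsHomogeneous.prod (Finset.range a)
          (fun k => (X s - C (k : K) * X 0 : MvPolynomial (Fin 3) K)) (fun _ => 1)
          (fun k _ => IsHomogeneous.sub (isHomogeneous_X K s) (isHomogeneous_C_mul_X _ _))
        simpa using this
      have := IsHomogeneous.mul (isHomogeneous_X_pow (R := K) (0 : Fin 3) (i - a - b))
        ((hp 1 a).mul (hp 2 b))
      have e : i - a - b + (a + b) = i := by omega
      rw [e] at this
      exact this
    · funext c
      rw [evPts_apply]
      simp [zz, vv, ffv, map_prod]

lemma vv_linInd (hb : ∀ i ≤ m, δ i ≤ i + 1) : LinearIndependent K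
    (fun c : idx δ m => vv K δ m c.1.2 (c.1.1 - c.1.2)) := by
  rw [Fintype.linearIndependent_iff]
  intro g hg
  have main : ∀ n, ∀ c : idx δ m, c.1.1 = n → g c = 0 := by
    intro n
    induction n using Nat.strong_induction_on with
    | _ n ih =>
      intro c hcn
      have h := congrFun hg c
      rw [Finset.sum_apply, Finset.sum_eq_single_of_mem c (Finset.mem_univ _)] at h
      · simp only [Pi.smul_apply, smul_eq_mul, Pi.zero_apply, mul_eq_zero] at h
        rcases h with h | h
        · exact h
        · simp only [vv] at h
          rw [ffv_eq_zero] at h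
          simp at h
      · intro d _ hdc
        simp only [Pi.smul_apply, smul_eq_mul, mul_eq_zero]
        by_cases hlt : d.1.1 < n
        · left; exact ih _ hlt d rfl
        · right
          simp only [vv]
          rw [ffv_eq_zero]
          rintro ⟨h1, h2⟩
          apply hdc
          obtain ⟨⟨k, x⟩, hd⟩ := d
          obtain ⟨⟨k', x'⟩, hc⟩ := c
          rw [mem_idx] at hd hc
          simp only at *
          have b1 := hb k hd.1
          have b2 := hb k' hc.1
          have e1 : x = x' := by omega
          have e2 : k = k' := by omega
          subst e1; subst e2; rfl
  exact fun c => main _ c rfl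

lemma finrank_evDeg_zz (hb : ∀ i ≤ m, δ i ≤ i + 1)
    (hs : ∀ i, i + 1 ≤ m → δ (i+1) ≤ δ i ∨ (δ i = i + 1 ∧ δ (i+1) ≤ i + 2)) (i : ℕ) (hi : i ≤ m) :
    Module.finrank K (evDeg (zz K δ m) i) = ∑ k ∈ Finset.range (i+1), δ k := by
  rw [evDeg_zz, ← card_idx]
  have hsub : ∀ c, c ∈ idx δ i → c ∈ idx δ m := by
    intro c; rw [mem_idx, mem_idx]; rintro ⟨h1, h2⟩; exact ⟨by omega, h2⟩
  let f : idx δ i → idx δ m := fun c => ⟨c.1, hsub c.1 c.2⟩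
  have hf : Function.Injective f := by
    intro c d h
    apply Subtype.ext
    have := congrArg Subtype.val h
    exact this
  have hli := (vv_linInd K hb).comp f hf
  have hspan : SS K δ m i = Submodule.span K (Set.range
      ((fun c : idx δ m => vv K δ m c.1.2 (c.1.1 - c.1.2)) ∘ f)) := by
    apply le_antisymm
    · unfold SS
      rw [Submodule.span_le]
      rintro _ ⟨a, b, hab, rfl⟩
      by_cases h : a + b ≤ m ∧ a < δ (a + b)
      · apply Submodule.subset_span
        refine ⟨⟨⟨a+b, a⟩, ?_⟩, ?_⟩
        · rw [mem_idx]; exact ⟨hab, h.2⟩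
        · simp [f]
      · rw [vv_eq_zero K hb hs a b h]; exact zero_mem _
    · rw [Submodule.span_le]
      rintro _ ⟨⟨⟨k, x⟩, hc⟩, rfl⟩
      apply Submodule.subset_span
      rw [mem_idx] at hc
      simp only at hc
      have := hb k (by omega)
      exact ⟨x, k - x, by omega, rfl⟩
  rw [hspan, finrank_span_eq_card hli]
  simp

lemma evDeg_zz_top (hb : ∀ i ≤ m, δ i ≤ i + 1)
    (hs : ∀ i, i + 1 ≤ m → δ (i+1) ≤ δ i ∨ (δ i = i + 1 ∧ δ (i+1) ≤ i + 2)) (i : ℕ) (hi : m ≤ i) : evDeg (zz K δ m) i = ⊤ := by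
  have h1 : evDeg (zz K δ m) m = ⊤ := by
    apply Submodule.eq_top_of_finrank_eq
    rw [finrank_evDeg_zz K hb hs m le_rfl, ← card_idx]
    simp
  rw [evDeg_zz] at h1 ⊢
  rw [eq_top_iff, ← h1]
  exact monotone_nat_of_le_succ (SS_mono K) hi

end pts

/-- Points in `P^3`: given points in a plane, plus one point outside. -/
def zz4 {K : Type*} [Field K] {ι : Type*} (z : ι → Fin 3 → K) : Option ι → Fin 4 → K
  | none => ![0, 0, 0, 1]
  | some c => ![z c 0, z c 1, z c 2, 0]

lemma evDeg_zz4 {K : Type*} [Field K] {ι : Type*} (z : ι → Fin 3 → K) (i : ℕ) (hi : 1 ≤ i)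
    (v : Option ι → K) : v ∈ evDeg (zz4 z) i ↔ (fun c => v (some c)) ∈ evDeg z i := by
  constructor
  · rintro ⟨g, hg, rfl⟩
    refine ⟨aeval (![X 0, X 1, X 2, 0] : Fin 4 → MvPolynomial (Fin 3) K) g, ?_, ?_⟩
    · have := IsHomogeneous.aeval (S := K) (n := 1) hg
        (![X 0, X 1, X 2, 0] : Fin 4 → MvPolynomial (Fin 3) K) (by
        intro k
        fin_cases k
        · exact isHomogeneous_X _ _
        · exact isHomogeneous_X _ _
        · exact isHomogeneous_X _ _
        · exact isHomogeneous_zero _ _ _)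
      rw [one_mul] at this
      exact this
    · funext c
      rw [evPts_apply, evPts_apply, ← MvPolynomial.aeval_eq_eval, ← MvPolynomial.aeval_eq_eval]
      change (aeval (z c)) (aeval _ g) = aeval (zz4 z (some c)) g
      rw [← AlgHom.comp_apply, MvPolynomial.comp_aeval]
      congr 2
      funext k
      fin_cases k <;> simp [zz4]
  · rintro ⟨g, hg, hgv⟩
    have hr0 : eval (zz4 z none) (rename (Fin.castSucc : Fin 3 → Fin 4) g) = 0 := by
      rw [eval_rename]
      have : (zz4 z none ∘ Fin.castSucc) = (0 : Fin 3 → K) := by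
        funext k; fin_cases k <;> simp [zz4]
      rw [this]
      have h2 : eval (0 : Fin 3 → K) g = coeff 0 g := by
        rw [← constantCoeff_eq, eval_zero]
      rw [h2]
      apply IsHomogeneous.coeff_eq_zero hg
      simp; omega
    refine ⟨rename (Fin.castSucc : Fin 3 → Fin 4) g + C (v none) * X 3 ^ i, ?_, ?_⟩
    · exact IsHomogeneous.add (IsHomogeneous.rename_isHomogeneous hg)
        (isHomogeneous_C_mul_X_pow _ _ _)
    · funext c
      rw [evPts_apply]
      cases c with
      | none =>
        rw [map_add, hr0]
        simp [zz4]
      | some c =>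
        have := congrFun hgv c
        rw [evPts_apply] at this
        rw [map_add, eval_rename]
        have e : (zz4 z (some c) ∘ Fin.castSucc) = z c := by
          funext k; fin_cases k <;> simp [zz4]
        rw [e, this]
        have : i ≠ 0 := by omega
        simp [zz4, this]

lemma evDeg_zz4_top {K : Type*} [Field K] {ι : Type*} (z : ι → Fin 3 → K) (i : ℕ) (hi : 1 ≤ i)
    (h : evDeg z i = ⊤) : evDeg (zz4 z) i = ⊤ := by
  rw [eq_top_iff]
  intro v _
  rw [evDeg_zz4 z i hi, h]; trivial

lemma finrank_evDeg_zz4 {K : Type*} [Field K] {ι : Type*} [Fintype ι] (z : ι → Fin 3 → K) (i : ℕ)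
    (hi : 1 ≤ i) :
    Module.finrank K (evDeg (zz4 z) i) = Module.finrank K (evDeg z i) + 1 := by
  let e : evDeg (zz4 z) i ≃ₗ[K] (evDeg z i × K) :=
    { toFun := fun v => (⟨fun c => v.1 (some c), (evDeg_zz4 z i hi v.1).1 v.2⟩, v.1 none)
      map_add' := by intro u v; rfl
      map_smul' := by intro u v; rfl
      invFun := fun p => ⟨fun o => o.elim p.2 p.1.1, (evDeg_zz4 z i hi _).2 p.1.2⟩
      left_inv := by
        intro v; apply Subtype.ext; funext o; cases o <;> rfl
      right_inv := by intro p; rfl }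
  rw [LinearEquiv.finrank_eq e, Module.finrank_prod, Module.finrank_self]

lemma finrank_evDeg_zero {n : ℕ} {K : Type*} [Field K] {ι : Type*} [Fintype ι] [Nonempty ι]
    (z : ι → Fin n → K) : Module.finrank K (evDeg z 0) = 1 := by
  have : evDeg z 0 = Submodule.span K {fun _ => (1 : K)} := by
    unfold evDeg
    rw [homogeneousSubmodule_zero, Submodule.one_eq_span, Submodule.map_span, Set.image_singleton]
    congr 2
    funext c
    simp [evPts_apply]
  rw [this, finrank_span_singleton]
  obtain ⟨c⟩ := ‹Nonempty ι›
  intro h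
  have := congrFun h c
  simp at this

theorem construct {K : Type*} [Field K] [CharZero K]
    (j : ℕ) (hj : 4 ≤ j) (h : ℕ → ℕ)
    (hsym : ∀ i ≤ j, h (j - i) = h i)
    (h0 : h 0 = 1) (h1 : h 1 = 4) (h2 : h 2 = 7) (H : DeltaOSeq h (j / 2)) :
    (∃ I : Ideal (MvPolynomial (Fin 4) K), IsAG 4 K I j ∧
        ∀ i ≤ j, hilb 4 K I i = h i) ∧
      (∃ I' : Ideal (MvPolynomial (Fin 3) K), IsAG 3 K I' j ∧
        hilb 3 K I' 0 = 1 ∧ hilb 3 K I' j = 1 ∧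
        ∀ i, 1 ≤ i → i ≤ j - 1 → hilb 3 K I' i = h i - 1) := by
  obtain ⟨δ, d0, d1, hδ, hb, hs⟩ := shape_of_deltaOSeq (j/2) h h0 h1 h2 H
  set m := j / 2 with hm
  have hsum : ∀ i, 1 ≤ i → i ≤ m → ∑ k ∈ Finset.range (i+1), δ k + 1 = h i := by
    intro i hi
    induction i, hi using Nat.le_induction with
    | base => intro _; simp [Finset.sum_range_succ, d0, d1, h1]
    | succ i hi ih =>
      intro him
      rw [Finset.sum_range_succ]
      have a := ih (by omega)
      have b := hδ (i+1) (by omega) him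
      simp at b
      omega
  have hne : Nonempty (idx δ m) := ⟨⟨⟨0, 0⟩, by rw [mem_idx]; simp [d0]⟩⟩
  have top3 := fun i hi => evDeg_zz_top K hb hs i hi
  have top4 : ∀ i, m ≤ i → evDeg (zz4 (zz K δ m)) i = ⊤ := fun i hi =>
    evDeg_zz4_top _ i (by omega) (top3 i hi)
  have f3 : ∀ i, 1 ≤ i → i ≤ m → Module.finrank K (evDeg (zz K δ m) i) = h i - 1 := by
    intro i hi him
    rw [finrank_evDeg_zz K hb hs i him, ← hsum i hi him]; simp
  have f4 : ∀ i ≤ m, Module.finrank K (evDeg (zz4 (zz K δ m)) i) = h i := by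
    intro i him
    by_cases c : i = 0
    · subst c; rw [finrank_evDeg_zero, h0]
    · rw [finrank_evDeg_zz4 _ i (by omega), finrank_evDeg_zz K hb hs i him, hsum i (by omega) him]
  constructor
  · obtain ⟨I, hI, ha, hc⟩ := points_AG (zz4 (zz K δ m)) j (top4 j (by omega))
    refine ⟨I, hI, ?_⟩
    intro i hi
    by_cases c : i ≤ m
    · rw [ha i hi (top4 _ (by omega)), f4 i c]
    · rw [hc i hi (top4 _ (by omega)), f4 _ (by omega), hsym i hi]
  · obtain ⟨I, hI, ha, hc⟩ := points_AG (zz K δ m) j (top3 j (by omega))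
    refine ⟨I, hI, ?_, ?_, ?_⟩
    · rw [ha 0 (by omega) (top3 _ (by omega)), finrank_evDeg_zero]
    · rw [hc j (by omega) (top3 _ (by omega)), Nat.sub_self, finrank_evDeg_zero]
    · intro i hi hij
      by_cases c : i ≤ m
      · rw [ha i (by omega) (top3 _ (by omega)), f3 i hi c]
      · rw [hc i (by omega) (top3 _ (by omega)), f3 _ (by omega) (by omega), hsym i (by omega)]


lemma comp_mul {n : ℕ} {K : Type*} [Field K] {d : ℕ} {f : MvPolynomial (Fin n) K}
    (hf : f.IsHomogeneous d) (i : ℕ) (a : MvPolynomial (Fin n) K) :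
    homogeneousComponent (i + d) (f * a) = f * homogeneousComponent i a := by
  conv_lhs => rw [← sum_homogeneousComponent a, Finset.mul_sum, map_sum]
  have : ∀ e, homogeneousComponent (i + d) (f * homogeneousComponent e a)
      = if e = i then f * homogeneousComponent i a else 0 := by
    intro e
    have hm : f * homogeneousComponent e a ∈ homogeneousSubmodule (Fin n) K (d + e) :=
      hf.mul (homogeneousComponent_isHomogeneous e a)
    rw [homogeneousComponent_of_mem hm]
    by_cases h : e = i
    · subst h; rw [if_pos (by omega), if_pos rfl]
    · rw [if_neg (by omega), if_neg h]
  simp_rw [this]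
  rw [Finset.sum_ite_eq']
  split_ifs with h
  · rfl
  · rw [Finset.mem_range, not_lt] at h
    rw [homogeneousComponent_eq_zero _ _ (by omega), mul_zero]

/-- degree `i` piece of `R/I` -/
def gr {n : ℕ} {K : Type*} [Field K] (I : Ideal (MvPolynomial (Fin n) K)) (i : ℕ) :
    Submodule K (MvPolynomial (Fin n) K ⧸ I) :=
  (homogeneousSubmodule (Fin n) K i).map (Ideal.Quotient.mkₐ K I).toLinearMap

section
variable {n : ℕ} {K : Type*} [Field K] {I : Ideal (MvPolynomial (Fin n) K)}

lemma hilb_eq (i : ℕ) : hilb n K I i = Module.finrank K (gr I i) := rfl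

lemma mem_gr {i : ℕ} {x : MvPolynomial (Fin n) K ⧸ I} :
    x ∈ gr I i ↔ ∃ f : MvPolynomial (Fin n) K, f.IsHomogeneous i ∧ Ideal.Quotient.mk I f = x := by
  simp only [gr, Submodule.mem_map]; rfl

lemma gr_fin (i : ℕ) : Module.Finite K (gr I i) :=
  Module.Finite.iff_fg.mpr ((homogeneousSubmodule_fg _ _ i).map _)

lemma gr_mul {i k : ℕ} {x y : MvPolynomial (Fin n) K ⧸ I} (hx : x ∈ gr I i) (hy : y ∈ gr I k) :
    x * y ∈ gr I (i + k) := by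
  obtain ⟨f, hf, rfl⟩ := mem_gr.1 hx
  obtain ⟨g, hg, rfl⟩ := mem_gr.1 hy
  exact mem_gr.2 ⟨f * g, hf.mul hg, map_mul _ _ _⟩

lemma hs_add (i k : ℕ) : homogeneousSubmodule (Fin n) K (i + k) =
    homogeneousSubmodule (Fin n) K i * homogeneousSubmodule (Fin n) K k := by
  have e := fun m => homogeneousSubmodule_one_pow (σ := Fin n) (R := K) m
  rw [← e, ← e i, ← e k, pow_add]

lemma gr_add (i k : ℕ) : gr I (i + k) = gr I i * gr I k := by
  unfold gr
  rw [← Submodule.map_mul, hs_add]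

lemma gr_succ (i : ℕ) : gr I (i + 1) = gr I 1 * gr I i := by
  rw [← gr_add, add_comm]

lemma gr_disj (hI : IdealHomog I) {i k : ℕ} (hik : i ≠ k) {x : MvPolynomial (Fin n) K ⧸ I}
    (hx : x ∈ gr I i) (hy : x ∈ gr I k) : x = 0 := by
  obtain ⟨f, hf, rfl⟩ := mem_gr.1 hx
  obtain ⟨g, hg, hgf⟩ := mem_gr.1 hy
  rw [Ideal.Quotient.eq] at hgf
  have := hI _ hgf i
  rw [map_sub, homogeneousComponent_of_mem (n := k) hg, homogeneousComponent_of_mem (n := i) hf,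
    if_neg hik, if_pos rfl, zero_sub, neg_mem_iff] at this
  exact Ideal.Quotient.eq_zero_iff_mem.2 this

/-- mult by `a` applied to `gr I d` -/
def mg (a : MvPolynomial (Fin n) K ⧸ I) (d : ℕ) : Submodule K (MvPolynomial (Fin n) K ⧸ I) :=
  (gr I d).map (LinearMap.mulLeft K a)

lemma mem_mg {a x : MvPolynomial (Fin n) K ⧸ I} {d : ℕ} :
    x ∈ mg a d ↔ ∃ y ∈ gr I d, a * y = x := by
  simp [mg, Submodule.mem_map]

lemma mg_fin (a : MvPolynomial (Fin n) K ⧸ I) (d : ℕ) : Module.Finite K (mg a d) := by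
  have := gr_fin (I := I) d
  exact Module.Finite.map _ _

lemma mg_le {a : MvPolynomial (Fin n) K ⧸ I} (ha : a ∈ gr I 1) (d : ℕ) : mg a d ≤ gr I (d+1) := by
  intro x hx
  obtain ⟨y, hy, rfl⟩ := mem_mg.1 hx
  rw [add_comm]
  exact gr_mul ha hy

lemma graded_two (hI : IdealHomog I) {L u a b x : MvPolynomial (Fin n) K ⧸ I}
    (hL : L ∈ gr I 1) (hu : u ∈ gr I 1) {s : ℕ} (hx : x ∈ gr I (s+1)) (h : x = L * a + u * b) :
    x ∈ mg L s ⊔ mg u s := by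
  obtain ⟨X0, hX, rfl⟩ := mem_gr.1 hx
  obtain ⟨L0, hL0, rfl⟩ := mem_gr.1 hL
  obtain ⟨u0, hu0, rfl⟩ := mem_gr.1 hu
  obtain ⟨a0, rfl⟩ := Ideal.Quotient.mk_surjective a
  obtain ⟨b0, rfl⟩ := Ideal.Quotient.mk_surjective b
  rw [← map_mul, ← map_mul, ← map_add, Ideal.Quotient.eq] at h
  have := hI _ h (s+1)
  rw [map_sub, map_add, comp_mul hL0, comp_mul hu0, homogeneousComponent_of_mem (n := s+1) hX,
    if_pos rfl, ← Ideal.Quotient.eq, map_add, map_mul, map_mul] at this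
  rw [this]
  refine Submodule.add_mem_sup (mem_mg.2 ⟨_, ?_, rfl⟩) (mem_mg.2 ⟨_, ?_, rfl⟩)
  · exact mem_gr.2 ⟨_, homogeneousComponent_isHomogeneous s a0, rfl⟩
  · exact mem_gr.2 ⟨_, homogeneousComponent_isHomogeneous s b0, rfl⟩

lemma gen_step {L u : MvPolynomial (Fin n) K ⧸ I} {s : ℕ}
    (h : gr I (s+1) ≤ mg L s ⊔ mg u s) (d : ℕ) (hd : s ≤ d) :
    gr I (d+1) ≤ mg L d ⊔ mg u d := by
  induction d, hd using Nat.le_induction with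
  | base => exact h
  | succ d _ ih =>
    rw [gr_succ, Submodule.mul_le]
    intro m hm x hx
    obtain ⟨y, hy, z, hz, rfl⟩ := Submodule.mem_sup.1 (ih hx)
    obtain ⟨y, hy', rfl⟩ := mem_mg.1 hy
    obtain ⟨z, hz', rfl⟩ := mem_mg.1 hz
    have : m * (L * y + u * z) = L * (m * y) + u * (m * z) := by ring
    rw [this, add_comm d 1]
    exact Submodule.add_mem_sup (mem_mg.2 ⟨_, gr_mul hm hy', rfl⟩) (mem_mg.2 ⟨_, gr_mul hm hz', rfl⟩)

lemma finrank_map_add_ker {V W : Type*} [AddCommGroup V] [Module K V] [AddCommGroup W] [Module K W]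
    (f : V →ₗ[K] W) (Q : Submodule K V) [Module.Finite K Q] :
    Module.finrank K (Q.map f) + Module.finrank K (Q ⊓ LinearMap.ker f : Submodule K V)
      = Module.finrank K Q := by
  rw [← LinearMap.finrank_range_add_finrank_ker (f.domRestrict Q), LinearMap.range_domRestrict,
    LinearMap.ker_domRestrict, ← Submodule.finrank_map_subtype_eq Q, Submodule.map_comap_subtype]

lemma finrank_map_le_aux {V W : Type*} [AddCommGroup V] [Module K V] [AddCommGroup W] [Module K W]
    (f : V →ₗ[K] W) (P Q : Submodule K V) [Module.Finite K Q] (h : P ≤ Q) :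
    Module.finrank K (Q.map f) + Module.finrank K P ≤ Module.finrank K (P.map f) + Module.finrank K Q := by
  have : Module.Finite K P := Submodule.finiteDimensional_of_le h
  have a := finrank_map_add_ker f Q
  have b := finrank_map_add_ker f P
  have : Module.Finite K (Q ⊓ LinearMap.ker f : Submodule K V) :=
    Submodule.finiteDimensional_of_le inf_le_left
  have c : Module.finrank K (P ⊓ LinearMap.ker f : Submodule K V) ≤
    Module.finrank K (Q ⊓ LinearMap.ker f : Submodule K V) :=
    Submodule.finrank_mono (inf_le_inf_right _ h)
  omega

lemma hdec_of_gen {L u : MvPolynomial (Fin n) K ⧸ I} (hL : L ∈ gr I 1) (hu : u ∈ gr I 1) {d : ℕ}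
    (h : gr I (d+1+1) ≤ mg L (d+1) ⊔ mg u (d+1)) :
    Module.finrank K (gr I (d+1+1)) + Module.finrank K (mg L d)
      ≤ Module.finrank K (gr I (d+1)) + Module.finrank K (mg L (d+1)) := by
  have := mg_fin L (d+1)
  have := mg_fin u (d+1)
  have := gr_fin (I := I) (d+1)
  have h1 := Submodule.finrank_mono h
  have h2 := Submodule.finrank_sup_add_finrank_inf_eq (mg L (d+1)) (mg u (d+1))
  have h3 := finrank_map_le_aux (LinearMap.mulLeft K u) (mg L d) (gr I (d+1)) (mg_le hL d)
  have h4 : (mg L d).map (LinearMap.mulLeft K u) ≤ mg L (d+1) ⊓ mg u (d+1) := by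
    rintro x ⟨y, hy, rfl⟩
    refine ⟨?_, y, mg_le hL d hy, rfl⟩
    obtain ⟨z, hz, rfl⟩ := mem_mg.1 hy
    refine mem_mg.2 ⟨u * z, ?_, ?_⟩
    · rw [add_comm]; exact gr_mul hu hz
    · simp only [LinearMap.mulLeft_apply]; ring
  have : Module.Finite K (mg L (d+1) ⊓ mg u (d+1) : Submodule K (MvPolynomial (Fin n) K ⧸ I)) :=
    Submodule.finiteDimensional_of_le inf_le_left
  have h5 := Submodule.finrank_mono h4
  change Module.finrank K (mg u (d+1)) + _ ≤ _ at h3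
  omega
end

section
variable {n : ℕ} {K : Type*} [Field K] {I : Ideal (MvPolynomial (Fin n) K)} {j : ℕ}

lemma gr_top (hA : IsAG n K I j) {i : ℕ} (hi : j < i) : gr I i = ⊥ := by
  have := hA.2.2.2.2 i hi
  rw [hilb_eq] at this
  have := gr_fin (I := I) i
  exact Submodule.finrank_eq_zero.1 ‹_›

lemma X_mem_gr (k : Fin n) : Ideal.Quotient.mk I (X k) ∈ gr I 1 :=
  mem_gr.2 ⟨X k, isHomogeneous_X _ _, rfl⟩

lemma socle_eq (hA : IsAG n K I j) : gr I j = socleSub n K I := by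
  have := hA.2.1
  apply Submodule.eq_of_le_of_finrank_le
  · intro x hx
    simp only [socleSub, Submodule.mem_iInf, LinearMap.mem_ker, LinearMap.mulLeft_apply]
    intro k
    have := gr_mul (X_mem_gr (I := I) k) hx
    rw [gr_top hA (by omega)] at this
    simpa using this
  · rw [hA.2.2.1]
    have := hA.2.2.2.1
    rw [hilb_eq] at this
    omega

lemma hilb_top (hA : IsAG n K I j) : hilb n K I j = 1 := by
  rw [hilb_eq, socle_eq hA, hA.2.2.1]

lemma nondeg (hA : IsAG n K I j) : ∀ (m i : ℕ), i + m = j → ∀ a ∈ gr I i, a ≠ 0 →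
    ∃ b ∈ gr I m, a * b ≠ 0 := by
  intro m
  induction m with
  | zero =>
    intro i _ a _ ha0
    exact ⟨1, mem_gr.2 ⟨1, isHomogeneous_one _ _, map_one _⟩, by simpa using ha0⟩
  | succ m ih =>
    intro i him a ha ha0
    have : ∃ k : Fin n, Ideal.Quotient.mk I (X k) * a ≠ 0 := by
      by_contra hc
      push Not at hc
      have : a ∈ gr I j := by
        rw [socle_eq hA]
        simpa only [socleSub, Submodule.mem_iInf, LinearMap.mem_ker, LinearMap.mulLeft_apply] using hc
      exact ha0 (gr_disj hA.1 (by omega) ha this)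
    obtain ⟨k, hk⟩ := this
    obtain ⟨b, hb, hb0⟩ := ih (1 + i) (by omega) _ (gr_mul (X_mem_gr k) ha) hk
    refine ⟨Ideal.Quotient.mk I (X k) * b, ?_, ?_⟩
    · rw [add_comm]; exact gr_mul (X_mem_gr k) hb
    · intro h; apply hb0; rw [← h]; ring

lemma rank_symm_aux {V W : Type*} [AddCommGroup V] [Module K V] [AddCommGroup W] [Module K W]
    [Module.Finite K V] [Module.Finite K W] (B : V →ₗ[K] W →ₗ[K] K) :
    Module.finrank K (LinearMap.range B) = Module.finrank K (LinearMap.range B.flip) := by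
  have h := LinearMap.finrank_range_dualMap_eq_finrank_range (f := (B : V →ₗ[K] Module.Dual K W))
  rw [← h]
  have e : B.flip = (LinearMap.dualMap (B : V →ₗ[K] Module.Dual K W)) ∘ₗ (Module.evalEquiv K W).toLinearMap := by
    ext w v; simp
  rw [e, LinearMap.range_comp_of_range_eq_top]
  · exact LinearEquiv.range _

lemma rank_symm (hA : IsAG n K I j) {L : MvPolynomial (Fin n) K ⧸ I} (hL : L ∈ gr I 1) {d e : ℕ}
    (hde : d + e + 1 = j) : Module.finrank K (mg L d) = Module.finrank K (mg L e) := by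
  have hfd := gr_fin (I := I) d
  have hfe := gr_fin (I := I) e
  have hne : ∃ x ∈ gr I j, x ≠ 0 := by
    by_contra hc
    push Not at hc
    have : gr I j = ⊥ := (Submodule.eq_bot_iff _).2 hc
    have h1 := hilb_top hA
    rw [hilb_eq, this, finrank_bot] at h1
    omega
  obtain ⟨x0, hx0, hx0'⟩ := hne
  obtain ⟨ψ, hψ⟩ : ∃ ψ : Module.Dual K (MvPolynomial (Fin n) K ⧸ I), ψ x0 ≠ 0 := by
    by_contra hc
    push Not at hc
    exact hx0' ((Module.forall_dual_apply_eq_zero_iff K x0).1 hc)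
  have hψ' : ∀ x ∈ gr I j, ψ x = 0 → x = 0 := by
    intro x hx h0
    have h1 := hilb_top hA
    rw [hilb_eq] at h1
    obtain ⟨c, hc⟩ := (finrank_eq_one_iff_of_nonzero' (⟨x0, hx0⟩ : gr I j)
      (fun h => hx0' (congrArg Subtype.val h))).1 h1 ⟨x, hx⟩
    have hc : c • x0 = x := congrArg Subtype.val hc
    rw [← hc, map_smul, smul_eq_mul] at h0
    rcases mul_eq_zero.1 h0 with h | h
    · rw [← hc, h, zero_smul]
    · exact absurd h hψ
  let Bil : (MvPolynomial (Fin n) K ⧸ I) →ₗ[K] (MvPolynomial (Fin n) K ⧸ I) →ₗ[K] K :=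
    ((LinearMap.mul K (MvPolynomial (Fin n) K ⧸ I)).compr₂ ψ) ∘ₗ LinearMap.mulLeft K L
  have hBil : ∀ a b, Bil a b = ψ (L * a * b) := fun a b => rfl
  let G : ∀ e, (MvPolynomial (Fin n) K ⧸ I) →ₗ[K] (gr I e →ₗ[K] K) :=
    fun e => (LinearMap.lcomp K K (gr I e).subtype) ∘ₗ Bil
  have hG : ∀ e a b, G e a b = ψ (L * a * b) := fun e a b => rfl
  have key : ∀ d e, d + e + 1 = j → Module.finrank K (mg L d)
      = Module.finrank K (LinearMap.range ((G e).domRestrict (gr I d))) := by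
    intro d e hde
    rw [LinearMap.range_domRestrict]
    apply finrank_map_congr
    intro a ha
    rw [LinearMap.mulLeft_apply]
    constructor
    · intro h
      ext b
      rw [hG, h]; simp
    · intro h
      by_contra hc
      obtain ⟨b, hb, hb0⟩ := nondeg hA e (d+1) (by omega) _ (mg_le hL d (mem_mg.2 ⟨a, ha, rfl⟩)) hc
      apply hb0
      apply hψ'
      · have := gr_mul (mg_le hL d (mem_mg.2 ⟨a, ha, rfl⟩)) hb
        have e2 : d + 1 + e = j := by omega
        rwa [e2] at this
      · have := LinearMap.congr_fun h ⟨b, hb⟩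
        rw [hG] at this
        exact this
  rw [key d e hde, key e d (by omega), rank_symm_aux]
  have E : ((G e).domRestrict (gr I d)).flip = (G d).domRestrict (gr I e) := by
    apply LinearMap.ext; intro a
    apply LinearMap.ext; intro b
    rw [LinearMap.flip_apply, LinearMap.domRestrict_apply, LinearMap.domRestrict_apply, hG, hG]
    congr 1
    ring
  rw [E]

/-- The algebraic heart: a generation statement in degree `t` gives (ii). -/
theorem delta_of_gen (hA : IsAG n K I j) (hsym : ∀ i ≤ j, hilb n K I (j - i) = hilb n K I i)
    (h0 : hilb n K I 0 = 1) (h1 : hilb n K I 1 = 3 ∨ hilb n K I 1 = 4) (s : ℕ) (hs : 2 ≤ s)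
    (hfull : ∀ i, 2 ≤ i → i ≤ s → hilb n K I i = hilb n K I (i - 1) + (i + 1))
    {L u : MvPolynomial (Fin n) K ⧸ I} (hL : L ∈ gr I 1) (hu : u ∈ gr I 1)
    (hgen : gr I (s+1) ≤ mg L s ⊔ mg u s) : DeltaOSeq (hilb n K I) (j / 2) := by
  apply deltaOSeq_of_ranks j _ (fun i => Module.finrank K (mg L (i-1))) (s+1) (by omega) hsym h0 h1
  · intro i hi1 hi2
    exact rank_symm hA hL (by omega)
  · intro i hi1 hi2
    exact hfull i hi1 (by omega)
  · intro d hd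
    obtain ⟨d, rfl⟩ : ∃ e, d = e + 1 := ⟨d - 1, by omega⟩
    exact hdec_of_gen hL hu (gen_step hgen (d+1) (by omega))

/-- Criterion for the generation statement: all `(s+1)`-forms die modulo `(L,u)`. -/
lemma gen_of_quot (hI : IdealHomog I) {L u : MvPolynomial (Fin n) K} (hL : L.IsHomogeneous 1)
    (hu : u.IsHomogeneous 1) (s : ℕ)
    (h : ∀ f : MvPolynomial (Fin n) K, f.IsHomogeneous (s+1) → f ∈ I ⊔ Ideal.span {L, u}) :
    gr I (s+1) ≤ mg (Ideal.Quotient.mk I L) s ⊔ mg (Ideal.Quotient.mk I u) s := by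
  intro x hx
  obtain ⟨f, hf, rfl⟩ := mem_gr.1 hx
  obtain ⟨y, hy, z, hz, hyz⟩ := Submodule.mem_sup.1 (h f hf)
  obtain ⟨a, b, rfl⟩ := Ideal.mem_span_pair.1 hz
  refine graded_two hI (mem_gr.2 ⟨_, hL, rfl⟩) (mem_gr.2 ⟨_, hu, rfl⟩) hx
    (a := Ideal.Quotient.mk I a) (b := Ideal.Quotient.mk I b) ?_
  rw [← map_mul, ← map_mul, ← map_add, Ideal.Quotient.eq, ← hyz]
  have : y + (a * L + b * u) - (L * a + u * b) = y := by ring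
  rwa [this]
end

section
variable {n : ℕ} {K : Type*} [Field K]

lemma hs_one_induction {P : MvPolynomial (Fin n) K → Prop} (hX : ∀ k, P (X k))
    (h0 : P 0) (hadd : ∀ x y, P x → P y → P (x + y)) (hsm : ∀ (c : K) x, P x → P (c • x))
    (x : MvPolynomial (Fin n) K) (hx : x.IsHomogeneous 1) : P x := by
  replace hx : x ∈ homogeneousSubmodule (Fin n) K 1 := hx
  rw [homogeneousSubmodule_one_eq_span_X] at hx
  induction hx using Submodule.span_induction with
  | mem x h => obtain ⟨k, rfl⟩ := h; exact hX k
  | zero => exact h0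
  | add x y _ _ hx hy => exact hadd x y hx hy
  | smul c x _ hx => exact hsm c x hx

lemma hs_mul_induction {P : MvPolynomial (Fin n) K → Prop} {i k : ℕ}
    (hm : ∀ x y : MvPolynomial (Fin n) K, x.IsHomogeneous i → y.IsHomogeneous k → P (x * y))
    (hadd : ∀ x y, P x → P y → P (x + y))
    (x : MvPolynomial (Fin n) K) (hx : x.IsHomogeneous (i + k)) : P x := by
  have : x ∈ homogeneousSubmodule (Fin n) K (i + k) := hx
  rw [hs_add] at this
  exact Submodule.mul_induction_on this (fun x hx y hy => hm x y hx hy) hadd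

lemma dual_forms (b : Module.Basis (Fin n) K (Fin n → K)) :
    ∃ s : Fin n → MvPolynomial (Fin n) K, (∀ i, (s i).IsHomogeneous 1) ∧
      (∀ x : MvPolynomial (Fin n) K, x.IsHomogeneous 1 → x = ∑ i, eval (b i) x • s i) ∧
      ∀ i k, eval (b i) (s k) = if i = k then 1 else 0 := by
  refine ⟨fun i => ∑ k, b.coord i (Pi.single k 1) • X k, ?_, ?_, ?_⟩
  · intro i
    apply IsHomogeneous.sum
    intro k _
    exact (homogeneousSubmodule (Fin n) K 1).smul_mem _ (isHomogeneous_X _ _)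
  · intro x hx
    refine hs_one_induction (P := fun x => x = ∑ i, eval (b i) x • 
      ∑ k, b.coord i (Pi.single k 1) • X k) ?_ (by simp) ?_ ?_ x hx
    · intro k
      simp only [eval_X, Finset.smul_sum, smul_smul]
      rw [Finset.sum_comm]
      simp_rw [← Finset.sum_smul]
      have : ∀ m, ∑ i, b i k * b.coord i (Pi.single m 1) = if m = k then 1 else 0 := by
        intro m
        have := congrFun (b.sum_repr (Pi.single m 1)) k
        simp only [Finset.sum_apply, Pi.smul_apply, smul_eq_mul] at this
        simp only [Module.Basis.coord_apply]
        simp_rw [mul_comm (b _ k)]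
        rw [this, Pi.single_apply]
        simp [eq_comm]
      simp_rw [this]
      simp
    · intro x y hx hy
      simp only [map_add, add_smul, Finset.sum_add_distrib]
      rw [← hx, ← hy]
    · intro c x hx
      simp only [smul_eval, mul_smul, ← Finset.smul_sum]
      rw [← hx]
  · intro i k
    simp only [map_sum, smul_eval, eval_X]
    have : b i = ∑ m, b i m • Pi.single m (1:K) := by
      ext l; simp [Pi.single_apply]
    have h2 := congrArg (b.coord k) this
    rw [map_sum] at h2
    simp only [map_smul, smul_eq_mul] at h2
    simp_rw [mul_comm _ (b i _)]
    rw [← h2, Module.Basis.coord_apply, Module.Basis.repr_self, Finsupp.single_apply]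

lemma finrank_hs (i : ℕ) : Module.finrank K (homogeneousSubmodule (Fin n) K i) =
    (n + i - 1).choose i := by
  have e : homogeneousSubmodule (Fin n) K i = Submodule.span K (Set.range
      (fun d : (Finset.univ : Finset (Fin n)).finsuppAntidiag i => monomial d.1 (1 : K))) := by
    apply le_antisymm
    · intro f hf
      rw [f.as_sum]
      apply Submodule.sum_mem
      intro d hd
      have : monomial d (coeff d f) = coeff d f • monomial d (1 : K) := by
        rw [smul_monomial, smul_eq_mul, mul_one]
      rw [this]
      apply Submodule.smul_mem
      apply Submodule.subset_span
      refine ⟨⟨d, ?_⟩, rfl⟩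
      rw [Finset.mem_finsuppAntidiag]
      refine ⟨?_, Finset.subset_univ _⟩
      have := hf (mem_support_iff.1 hd)
      rw [Finsupp.weight_apply, Finsupp.sum_fintype _ _ (by simp)] at this
      simpa using this
    · rw [Submodule.span_le]
      rintro _ ⟨⟨d, hd⟩, rfl⟩
      apply isHomogeneous_monomial
      rw [Finset.mem_finsuppAntidiag] at hd
      change d.degree = i
      rw [← hd.1, Finsupp.degree_apply]
      apply Finset.sum_subset (Finset.subset_univ _)
      intro x _ hx
      simpa using hx
  rw [e, finrank_span_eq_card, Fintype.card_coe, Finset.card_finsuppAntidiag_nat_eq_choose]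
  · simp
  · have := (basisMonomials (Fin n) K).linearIndependent.comp
      (fun d : (Finset.univ : Finset (Fin n)).finsuppAntidiag i => d.1) Subtype.val_injective
    simpa [Function.comp_def] using this

lemma power_kill {T : Type*} [CommRing T] [Algebra K T] (φ : MvPolynomial (Fin n) K →ₐ[K] T)
    (p m : Fin n → K) (s w : T) (hφ : ∀ x : MvPolynomial (Fin n) K, x.IsHomogeneous 1 →
      φ x = eval p x • s + eval m x • w) (hsw : s * w = 0) (hww : w * w = 0) (i : ℕ) :
    ∀ f : MvPolynomial (Fin n) K, f.IsHomogeneous (i + 2) → φ f = eval p f • s ^ (i+2) := by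
  have hadd : ∀ i, ∀ x y : MvPolynomial (Fin n) K, φ x = eval p x • s ^ i → φ y = eval p y • s ^ i →
      φ (x + y) = eval p (x + y) • s ^ i := by
    intro i x y hx hy
    rw [map_add, hx, hy, map_add, add_smul]
  induction i with
  | zero =>
    refine hs_mul_induction (i := 1) (k := 1) ?_ (hadd _)
    intro x y hx hy
    rw [map_mul, hφ x hx, hφ y hy, map_mul]
    simp only [Algebra.smul_def, map_mul]
    linear_combination (algebraMap K T (eval p x) * algebraMap K T (eval m y) + 
      algebraMap K T (eval m x) * algebraMap K T (eval p y)) * hsw 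
      + algebraMap K T (eval m x) * algebraMap K T (eval m y) * hww
  | succ i ih =>
    have e : i + 1 + 2 = 1 + (i + 2) := by omega
    rw [e]
    refine hs_mul_induction ?_ (hadd _)
    intro x y hx hy
    rw [map_mul, hφ x hx, ih y hy, map_mul]
    simp only [Algebra.smul_def, map_mul]
    linear_combination algebraMap K T (eval m x) * algebraMap K T (eval p y) * s^(i+1) * hsw
end

section
variable {n : ℕ} {K : Type*} [Field K]

lemma hs_fin (i : ℕ) : Module.Finite K (homogeneousSubmodule (Fin n) K i) :=
  Module.Finite.iff_fg.mpr (homogeneousSubmodule_fg _ _ i)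

/-- forms of degree `i` in `I` -/
def Ideg (I : Ideal (MvPolynomial (Fin n) K)) (i : ℕ) : Submodule K (MvPolynomial (Fin n) K) :=
  homogeneousSubmodule (Fin n) K i ⊓ LinearMap.ker (Ideal.Quotient.mkₐ K I).toLinearMap

lemma mem_Ideg {I : Ideal (MvPolynomial (Fin n) K)} {i : ℕ} {f : MvPolynomial (Fin n) K} :
    f ∈ Ideg I i ↔ f.IsHomogeneous i ∧ f ∈ I := by
  simp only [Ideg, Submodule.mem_inf, LinearMap.mem_ker]
  exact and_congr Iff.rfl Ideal.Quotient.eq_zero_iff_mem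

lemma Ideg_fin (I : Ideal (MvPolynomial (Fin n) K)) (i : ℕ) : Module.Finite K (Ideg I i) := by
  have := hs_fin (n := n) (K := K) i
  exact Submodule.finiteDimensional_of_le inf_le_left

lemma hilb_add_Ideg (I : Ideal (MvPolynomial (Fin n) K)) (i : ℕ) :
    hilb n K I i + Module.finrank K (Ideg I i) = (n + i - 1).choose i := by
  have := hs_fin (n := n) (K := K) i
  rw [← finrank_hs (K := K), hilb, Ideg]
  exact finrank_map_add_ker _ _

lemma exists_eval_ne [Infinite K] {f : MvPolynomial (Fin n) K} (hf : f ≠ 0) : ∃ p, eval p f ≠ 0 := by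
  by_contra hc
  push Not at hc
  exact hf (MvPolynomial.funext (fun p => by rw [hc p, map_zero]))

lemma basis_of_li [NeZero n] (v : Fin n → (Fin n → K)) (hv : LinearIndependent K v) :
    ∃ b : Module.Basis (Fin n) K (Fin n → K), ∀ i, b i = v i :=
  ⟨basisOfLinearIndependentOfCardEqFinrank hv (by simp), fun i => by simp⟩

lemma choose_step (i : ℕ) (hi : 2 ≤ i) : (3 + i - 1).choose i = (3 + (i - 1) - 1).choose (i-1) + (i+1) := by
  obtain ⟨k, rfl⟩ : ∃ k, i = k + 1 := ⟨i - 1, by omega⟩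
  have e1 : 3 + (k+1) - 1 = k + 2 + 1 := by omega
  have e2 : 3 + (k + 1 - 1) - 1 = k + 2 := by omega
  rw [e1, e2, Nat.choose_succ_succ]
  have : (k+2).choose (k+1) = k + 2 := Nat.choose_succ_self_right (k+1)
  simp only [Nat.succ_eq_add_one, Nat.add_sub_cancel, this]

lemma eval_zero_of_hom {i : ℕ} (hi : 1 ≤ i) {f : MvPolynomial (Fin n) K} (hf : f.IsHomogeneous i) :
    eval (0 : Fin n → K) f = 0 := by
  rw [eval_zero, constantCoeff_eq]
  by_contra hc
  have := hf hc
  simp at this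
  omega

theorem delta3 [CharZero K] {I : Ideal (MvPolynomial (Fin 3) K)} {j : ℕ} (hA : IsAG 3 K I j)
    (hsym : ∀ i ≤ j, hilb 3 K I (j - i) = hilb 3 K I i)
    (h0 : hilb 3 K I 0 = 1) (h1 : hilb 3 K I 1 = 3) (h2 : hilb 3 K I 2 = 6) :
    DeltaOSeq (hilb 3 K I) (j / 2) := by
  classical
  have hex : ∃ i, Ideg I i ≠ ⊥ := by
    refine ⟨j+1, fun h => ?_⟩
    have := hilb_add_Ideg I (j+1)
    rw [h, finrank_bot, hA.2.2.2.2 _ (by omega)] at this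
    have : 0 < (3 + (j + 1) - 1).choose (j+1) := Nat.choose_pos (by omega)
    omega
  obtain ⟨t, ht, hmin⟩ : ∃ t, Ideg I t ≠ ⊥ ∧ ∀ i < t, Ideg I i = ⊥ :=
    ⟨Nat.find hex, Nat.find_spec hex, fun i hi => by simpa using Nat.find_min hex hi⟩
  have hlow : ∀ i, hilb 3 K I i = (3 + i - 1).choose i → Ideg I i = ⊥ := by
    intro i hi
    have := hilb_add_Ideg I i
    have := Ideg_fin I i
    exact Submodule.finrank_eq_zero.1 (by omega)
  have ht3 : 3 ≤ t := by
    by_contra hc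
    have : t = 0 ∨ t = 1 ∨ t = 2 := by omega
    rcases this with rfl | rfl | rfl
    · exact ht (hlow _ (by rw [h0]; rfl))
    · exact ht (hlow _ (by rw [h1]; rfl))
    · exact ht (hlow _ (by rw [h2]; rfl))
  have hh : ∀ i < t, hilb 3 K I i = (3 + i - 1).choose i := by
    intro i hi
    have := hilb_add_Ideg I i
    rw [hmin i hi, finrank_bot] at this
    omega
  obtain ⟨f, hf, hf0⟩ := Submodule.exists_mem_ne_zero_of_ne_bot ht
  obtain ⟨hfh, hfI⟩ := mem_Ideg.1 hf
  obtain ⟨p, hp⟩ := exists_eval_ne hf0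
  have hp0 : p ≠ 0 := by
    rintro rfl
    exact hp (eval_zero_of_hom (by omega) hfh)
  have li1 : LinearIndependent K ![p] := LinearIndependent.of_subsingleton 0 (by simpa using hp0)
  obtain ⟨q, li2⟩ := exists_linearIndependent_cons_of_lt_finrank li1 (by simp)
  obtain ⟨r, li3⟩ := exists_linearIndependent_cons_of_lt_finrank li2 (by simp)
  obtain ⟨b, hb⟩ := basis_of_li _ li3
  obtain ⟨s, hs1, hs2, -⟩ := dual_forms b
  obtain ⟨k, rfl⟩ : ∃ k, t = k + 2 := ⟨t - 2, by omega⟩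
  refine delta_of_gen hA hsym h0 (Or.inl h1) (k+1) (by omega) ?_
    (mem_gr.2 ⟨_, hs1 0, rfl⟩) (mem_gr.2 ⟨_, hs1 1, rfl⟩) (gen_of_quot hA.1 (hs1 0) (hs1 1) _ ?_)
  · intro i hi1 hi2
    rw [hh i (by omega), hh (i-1) (by omega), choose_step i hi1]
  · intro g hg
    set J := I ⊔ Ideal.span {s 0, s 1} with hJ
    have z0 : Ideal.Quotient.mk J (s 0) = 0 := Ideal.Quotient.eq_zero_iff_mem.2
      (Ideal.mem_sup_right (Ideal.subset_span (by simp)))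
    have z1 : Ideal.Quotient.mk J (s 1) = 0 := Ideal.Quotient.eq_zero_iff_mem.2
      (Ideal.mem_sup_right (Ideal.subset_span (by simp)))
    have hφ := power_kill (Ideal.Quotient.mkₐ K J) p p (Ideal.Quotient.mk J (s 2)) 0 (by
      intro x hx
      conv_lhs => rw [hs2 x hx]
      have e : b 2 = p := by rw [hb]; rfl
      rw [map_sum, Fin.sum_univ_three]
      simp [z0, z1, e]) (by simp) (by simp) k
    have e1 := hφ f hfh
    have e2 := hφ g hg
    have : (Ideal.Quotient.mkₐ K J) f = 0 :=
      Ideal.Quotient.eq_zero_iff_mem.2 (Ideal.mem_sup_left hfI)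
    rw [this] at e1
    rcases smul_eq_zero.1 e1.symm with h | h
    · exact absurd h hp
    · rw [h, smul_zero] at e2
      exact Ideal.Quotient.eq_zero_iff_mem.1 e2
end

section
variable {n : ℕ} {K : Type*} [Field K]

/-- directional derivative -/
def Dd (e : Fin n → K) : Derivation K (MvPolynomial (Fin n) K) (MvPolynomial (Fin n) K) :=
  mkDerivation K (fun k => C (e k))

lemma Dd_lin (e : Fin n → K) (x : MvPolynomial (Fin n) K) (hx : x.IsHomogeneous 1) :
    Dd e x = C (eval e x) := by
  refine hs_one_induction (P := fun x => Dd e x = C (eval e x)) ?_ (by simp) ?_ ?_ x hx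
  · intro k; simp [Dd, mkDerivation_X]
  · intro x y hx hy; simp [hx, hy]
  · intro c x hx; rw [Derivation.map_smul, hx, smul_eval, map_mul, smul_eq_C_mul]

lemma Dd_mul (e : Fin n → K) (x y : MvPolynomial (Fin n) K) (hx : x.IsHomogeneous 1)
    (hy : y.IsHomogeneous 1) : Dd e (x * y) = eval e y • x + eval e x • y := by
  rw [Derivation.leibniz, Dd_lin e x hx, Dd_lin e y hy]
  simp only [smul_eq_mul, smul_eq_C_mul]; ring

lemma Dd_hom (e : Fin n → K) (q : MvPolynomial (Fin n) K) (hq : q.IsHomogeneous 2) :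
    (Dd e q).IsHomogeneous 1 := by
  refine hs_mul_induction (P := fun q => (Dd e q).IsHomogeneous 1) (i := 1) (k := 1) ?_ ?_ q hq
  · intro x y hx hy
    rw [Dd_mul e x y hx hy]
    exact (homogeneousSubmodule (Fin n) K 1).add_mem
      ((homogeneousSubmodule (Fin n) K 1).smul_mem _ hx)
      ((homogeneousSubmodule (Fin n) K 1).smul_mem _ hy)
  · intro x y hx hy
    rw [map_add]; exact hx.add hy

lemma Dd_euler (e : Fin n → K) (q : MvPolynomial (Fin n) K) (hq : q.IsHomogeneous 2) :
    eval e (Dd e q) = 2 * eval e q := by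
  refine hs_mul_induction (P := fun q => eval e (Dd e q) = 2 * eval e q) (i := 1) (k := 1) ?_ ?_ q hq
  · intro x y hx hy
    rw [Dd_mul e x y hx hy]
    simp only [map_add, smul_eval, map_mul]; ring
  · intro x y hx hy
    rw [map_add, map_add, map_add, hx, hy]; ring

lemma quad_eval {T : Type*} [CommRing T] [Algebra K T] (φ : MvPolynomial (Fin n) K →ₐ[K] T)
    (p e : Fin n → K) (s w : T) (hφ : ∀ x : MvPolynomial (Fin n) K, x.IsHomogeneous 1 →
      φ x = eval p x • s + eval e x • w) (q : MvPolynomial (Fin n) K) (hq : q.IsHomogeneous 2) :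
    φ q = eval p q • s ^ 2 + eval p (Dd e q) • (s * w) + eval e q • w ^ 2 := by
  refine hs_mul_induction (P := fun q => φ q = eval p q • s ^ 2 + eval p (Dd e q) • (s * w) 
    + eval e q • w ^ 2) (i := 1) (k := 1) ?_ ?_ q hq
  · intro x y hx hy
    rw [map_mul, hφ x hx, hφ y hy, Dd_mul e x y hx hy]
    simp only [map_mul, map_add, smul_eval]
    simp only [Algebra.smul_def, map_mul, map_add]
    ring
  · intro x y hx hy
    simp only [map_add, hx, hy, add_smul]
    ring

lemma lin_smul (a : K) (e : Fin n → K) (x : MvPolynomial (Fin n) K) (hx : x.IsHomogeneous 1) :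
    eval (a • e) x = a * eval e x := by
  refine hs_one_induction (P := fun x => eval (a • e) x = a * eval e x) ?_ (by simp) ?_ ?_ x hx
  · intro k; simp
  · intro x y hx hy; rw [map_add, map_add, hx, hy]; ring
  · intro c x hx; rw [smul_eval, smul_eval, hx]; ring

lemma quad_smul (a : K) (e : Fin n → K) (q : MvPolynomial (Fin n) K) (hq : q.IsHomogeneous 2) :
    eval (a • e) q = a ^ 2 * eval e q := by
  refine hs_mul_induction (P := fun q => eval (a • e) q = a ^ 2 * eval e q) (i := 1) (k := 1) ?_ ?_ q hq
  · intro x y hx hy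
    rw [map_mul, map_mul, lin_smul a e x hx, lin_smul a e y hy]; ring
  · intro x y hx hy; rw [map_add, map_add, hx, hy]; ring

lemma sylv {T : Type*} [CommRing T] [Algebra K T] (A B E P Q : K) (s w : T) (hE : E ≠ 0)
    (hR : E * P^2 - B * Q * P + A * Q^2 ≠ 0)
    (hF : A • s^2 + B • (s * w) + E • w^2 = 0) (hG : P • s^2 + Q • (s * w) = 0) :
    s^3 = 0 ∧ s^2 * w = 0 ∧ s * w^2 = 0 ∧ w^3 = 0 := by
  have can : ∀ (c : K) (x : T), c ≠ 0 → algebraMap K T c * x = 0 → x = 0 := by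
    intro c x hc h
    rw [← Algebra.smul_def] at h
    exact (smul_eq_zero_iff_right hc).1 h
  simp only [Algebra.smul_def] at hF hG
  have m0 : s^3 = 0 := by
    apply can _ _ hR
    simp only [map_add, map_sub, map_mul, map_pow]
    set A' := algebraMap K T A
    set B' := algebraMap K T B
    set E' := algebraMap K T E
    set P' := algebraMap K T P
    set Q' := algebraMap K T Q
    linear_combination (P' * E' - Q' * B') * s * hG - Q' * E' * w * hG + Q'^2 * s * hF
  have m1 : s^2 * w = 0 := by
    apply can _ _ hR
    simp only [map_add, map_sub, map_mul, map_pow]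
    set A' := algebraMap K T A
    set B' := algebraMap K T B
    set E' := algebraMap K T E
    set P' := algebraMap K T P
    set Q' := algebraMap K T Q
    linear_combination Q' * A' * s * hG + P' * E' * w * hG - P' * Q' * s * hF
  have m2 : s * w^2 = 0 := by
    apply can _ _ hR
    simp only [map_add, map_sub, map_mul, map_pow]
    set A' := algebraMap K T A
    set B' := algebraMap K T B
    set E' := algebraMap K T E
    set P' := algebraMap K T P
    set Q' := algebraMap K T Q
    linear_combination -P' * A' * s * hG + (Q' * A' - P' * B') * w * hG + P'^2 * s * hF
  refine ⟨m0, m1, m2, can E _ hE ?_⟩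
  linear_combination w * hF - algebraMap K T A * m1 - algebraMap K T B * m2

lemma relprime_aux [CharZero K] {f g : MvPolynomial (Fin n) K} (hf : f.IsHomogeneous 2)
    (hg : g.IsHomogeneous 2) (hf0 : f ≠ 0) (hfg : IsRelPrime f g) :
    ∃ (e p : Fin n → K) (g' : MvPolynomial (Fin n) K), g'.IsHomogeneous 2 ∧ 
      (∃ α β : K, g' = α • g + β • f) ∧ eval e f ≠ 0 ∧ eval e g' = 0 ∧
      eval e f * (eval p g')^2 - eval p (Dd e f) * eval p (Dd e g') * eval p g'
        + eval p f * (eval p (Dd e g'))^2 ≠ 0 := by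
  obtain ⟨e, he⟩ := exists_eval_ne hf0
  set g' := eval e f • g - eval e g • f with hg'
  have hg'h : g'.IsHomogeneous 2 :=
    (homogeneousSubmodule (Fin n) K 2).sub_mem ((homogeneousSubmodule (Fin n) K 2).smul_mem _ hg)
      ((homogeneousSubmodule (Fin n) K 2).smul_mem _ hf)
  have hge : eval e g' = 0 := by
    simp only [hg', map_sub, smul_eval]; ring
  have hfg' : IsRelPrime f g' := by
    intro d hd1 hd2
    apply hfg hd1
    have : g = (eval e f)⁻¹ • (g' + eval e g • f) := by
      rw [hg', sub_add_cancel, smul_smul, inv_mul_cancel₀ he, one_smul]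
    rw [this]
    rw [smul_eq_C_mul, smul_eq_C_mul]
    exact (dvd_add hd2 (hd1.mul_left _)).mul_left _
  have hg'0 : g' ≠ 0 := by
    intro h
    rw [h] at hfg'
    have hu : IsUnit f := hfg' dvd_rfl (dvd_zero _)
    have := hu.map (eval (0 : Fin n → K))
    rw [eval_zero_of_hom (by omega) hf] at this
    exact not_isUnit_zero this
  set a := Dd e f
  set c := Dd e g' with hc
  have hch : c.IsHomogeneous 1 := Dd_hom e g' hg'h
  have hce : eval e c = 0 := by rw [hc, Dd_euler e g' hg'h, hge, mul_zero]
  have hDc : Dd e c = 0 := by rw [Dd_lin e c hch, hce, map_zero]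
  have hr : C (eval e f) * g'^2 - a * c * g' + f * c^2 ≠ 0 := by
    intro h
    have hd : g' ∣ f * c^2 := ⟨a * c - C (eval e f) * g', by linear_combination h⟩
    have hd2 : g' ∣ c^2 := hfg'.symm.dvd_of_dvd_mul_left hd
    obtain ⟨k, hk⟩ := hd2
    have hc2 : (c^2).IsHomogeneous 2 := by simpa using hch.pow 2
    have h1 : c^2 = g' * C (coeff 0 k) := by
      have := congrArg (homogeneousComponent (0 + 2)) hk
      rw [comp_mul hg'h, homogeneousComponent_zero, homogeneousComponent_of_mem (n := 2) hc2] at this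
      simpa using this
    have h2 := congrArg (Dd e) h1
    rw [pow_two, Derivation.leibniz, hDc, Derivation.leibniz, ← hc] at h2
    have hDC : Dd e (C (coeff 0 k)) = 0 := Derivation.map_algebraMap (Dd e) (coeff 0 k)
    rw [hDC] at h2
    simp only [mul_zero, add_zero, zero_add, smul_eq_mul] at h2
    have hc0 : c = 0 := by
      rcases mul_eq_zero.1 h2.symm with h | h
      · rw [h, mul_zero] at h1
        exact pow_eq_zero_iff (two_ne_zero) |>.1 h1
      · exact h
    rw [hc0] at h
    have : C (eval e f) * g'^2 = 0 := by linear_combination h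
    rcases mul_eq_zero.1 this with h | h
    · exact he (by simpa using h)
    · exact hg'0 (pow_eq_zero_iff (two_ne_zero) |>.1 h)
  obtain ⟨p, hp⟩ := exists_eval_ne hr
  refine ⟨e, p, g', hg'h, ⟨eval e f, -eval e g, by rw [hg', neg_smul, sub_eq_add_neg]⟩, he, hge, ?_⟩
  simpa using hp

lemma cubic_kill {T : Type*} [CommRing T] [Algebra K T] (φ : MvPolynomial (Fin n) K →ₐ[K] T)
    (p e : Fin n → K) (s w : T) (hφ : ∀ x : MvPolynomial (Fin n) K, x.IsHomogeneous 1 →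
      φ x = eval p x • s + eval e x • w)
    {f g : MvPolynomial (Fin n) K} (hf : f.IsHomogeneous 2) (hg : g.IsHomogeneous 2)
    (he : eval e f ≠ 0) (hge : eval e g = 0)
    (hR : eval e f * (eval p g)^2 - eval p (Dd e f) * eval p (Dd e g) * eval p g
        + eval p f * (eval p (Dd e g))^2 ≠ 0) (hfI : φ f = 0) (hgI : φ g = 0)
    (h : MvPolynomial (Fin n) K) (hh : h.IsHomogeneous (2+1)) : φ h = 0 := by
  have hq := quad_eval φ p e s w hφ
  have hF := hq f hf
  have hG := hq g hg
  rw [hfI] at hF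
  rw [hgI, hge, zero_smul, add_zero] at hG
  obtain ⟨m0, m1, m2, m3⟩ := sylv _ _ _ _ _ _ _ he hR hF.symm hG.symm
  refine hs_mul_induction (P := fun h => φ h = 0) (i := 2) (k := 1) ?_ ?_ h hh
  · intro x y hx hy
    rw [map_mul, hq x hx, hφ y hy]
    simp only [Algebra.smul_def]
    generalize algebraMap K T (eval p x) = a1
    generalize algebraMap K T (eval p y) = a2
    generalize algebraMap K T (eval e x) = a3
    generalize algebraMap K T (eval e y) = a4
    generalize algebraMap K T (eval p (Dd e x)) = a5
    linear_combination a1 * a2 * m0 + (a1 * a4 + a5 * a2) * m1 + (a3 * a2 + a5 * a4) * m2 +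
      a3 * a4 * m3
  · intro x y hx hy; rw [map_add, hx, hy, add_zero]

theorem caseA [CharZero K] {I : Ideal (MvPolynomial (Fin 4) K)} {f g : MvPolynomial (Fin 4) K}
    (hf : f.IsHomogeneous 2) (hg : g.IsHomogeneous 2) (hf0 : f ≠ 0) (hfg : IsRelPrime f g)
    (hfI : f ∈ I) (hgI : g ∈ I) : ∃ L u : MvPolynomial (Fin 4) K, L.IsHomogeneous 1 ∧
      u.IsHomogeneous 1 ∧ ∀ h : MvPolynomial (Fin 4) K, h.IsHomogeneous (2+1) →
        h ∈ I ⊔ Ideal.span {L, u} := by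
  obtain ⟨e, p, g', hg', ⟨α, β, hαβ⟩, he, hge, hR⟩ := relprime_aux hf hg hf0 hfg
  have hg'I : g' ∈ I := by
    rw [hαβ, smul_eq_C_mul, smul_eq_C_mul]
    exact I.add_mem (I.mul_mem_left _ hgI) (I.mul_mem_left _ hfI)
  have he0 : e ≠ 0 := by
    rintro rfl
    exact he (eval_zero_of_hom (by omega) hf)
  have li2 : LinearIndependent K ![e, p] := by
    rw [LinearIndependent.pair_iff' he0]
    rintro a rfl
    apply hR
    rw [quad_smul a e g' hg', hge, lin_smul a e _ (Dd_hom e g' hg'), Dd_euler e g' hg', hge]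
    ring
  obtain ⟨q, li3⟩ := exists_linearIndependent_cons_of_lt_finrank li2 (by simp)
  obtain ⟨r, li4⟩ := exists_linearIndependent_cons_of_lt_finrank li3 (by simp)
  obtain ⟨b, hb⟩ := basis_of_li _ li4
  obtain ⟨s, hs1, hs2, -⟩ := dual_forms b
  refine ⟨s 0, s 1, hs1 0, hs1 1, ?_⟩
  set J := I ⊔ Ideal.span {s 0, s 1} with hJ
  have z0 : Ideal.Quotient.mk J (s 0) = 0 := Ideal.Quotient.eq_zero_iff_mem.2
    (Ideal.mem_sup_right (Ideal.subset_span (by simp)))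
  have z1 : Ideal.Quotient.mk J (s 1) = 0 := Ideal.Quotient.eq_zero_iff_mem.2
    (Ideal.mem_sup_right (Ideal.subset_span (by simp)))
  have hφ : ∀ x : MvPolynomial (Fin 4) K, x.IsHomogeneous 1 → (Ideal.Quotient.mkₐ K J) x =
      eval e x • (Ideal.Quotient.mk J (s 2)) + eval p x • (Ideal.Quotient.mk J (s 3)) := by
    intro x hx
    conv_lhs => rw [hs2 x hx]
    have e1 : b 2 = e := by rw [hb]; rfl
    have e2 : b 3 = p := by rw [hb]; rfl
    rw [map_sum, Fin.sum_univ_four]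
    simp [z0, z1, e1, e2]
  intro h hh
  apply Ideal.Quotient.eq_zero_iff_mem.1
  exact cubic_kill (Ideal.Quotient.mkₐ K J) p e _ _ (fun x hx => by rw [hφ x hx, add_comm]) hf hg' he hge
    hR (Ideal.Quotient.eq_zero_iff_mem.2 (Ideal.mem_sup_left hfI))
    (Ideal.Quotient.eq_zero_iff_mem.2 (Ideal.mem_sup_left hg'I)) h hh
end

section
variable {n : ℕ} {K : Type*} [Field K]

lemma not_unit_hom {i : ℕ} (hi : 1 ≤ i) {f : MvPolynomial (Fin n) K} (hf : f.IsHomogeneous i) :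
    ¬ IsUnit f := by
  intro hu
  have := hu.map (eval (0 : Fin n → K))
  rw [eval_zero_of_hom hi hf] at this
  exact not_isUnit_zero this

lemma unit_of_deg {f : MvPolynomial (Fin n) K} (hf : f ≠ 0) (h : f.totalDegree = 0) : IsUnit f := by
  rw [totalDegree_eq_zero_iff_eq_C] at h
  rw [h] at hf ⊢
  apply IsUnit.map
  rw [isUnit_iff_ne_zero]
  intro h; rw [h] at hf; simp at hf

lemma lin_irred {l : MvPolynomial (Fin n) K} (hl : l.IsHomogeneous 1) (h0 : l ≠ 0) :
    Irreducible l := by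
  refine ⟨not_unit_hom le_rfl hl, ?_⟩
  intro a b hab
  have ha : a ≠ 0 := by rintro rfl; simp at hab; exact h0 hab
  have hb : b ≠ 0 := by rintro rfl; simp at hab; exact h0 hab
  have h1 := hl.totalDegree h0
  rw [hab, totalDegree_mul_of_isDomain ha hb] at h1
  by_cases c : a.totalDegree = 0
  · exact Or.inl (unit_of_deg ha c)
  · exact Or.inr (unit_of_deg hb (by omega))

lemma quad_factor {f : MvPolynomial (Fin n) K} (hf : f.IsHomogeneous 2) (h0 : f ≠ 0)
    (hirr : ¬ Irreducible f) : ∃ a b : MvPolynomial (Fin n) K, a.IsHomogeneous 1 ∧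
      b.IsHomogeneous 1 ∧ a ≠ 0 ∧ b ≠ 0 ∧ f = a * b := by
  rw [irreducible_iff] at hirr
  push Not at hirr
  obtain ⟨a, b, hab, hau, hbu⟩ := hirr (not_unit_hom (by omega) hf)
  have ha : a ≠ 0 := by rintro rfl; simp at hab; exact h0 hab
  have hb : b ≠ 0 := by rintro rfl; simp at hab; exact h0 hab
  have h1 := hf.totalDegree h0
  rw [hab, totalDegree_mul_of_isDomain ha hb] at h1
  have ha1 : a.totalDegree ≠ 0 := fun h => hau (unit_of_deg ha h)
  have hb1 : b.totalDegree ≠ 0 := fun h => hbu (unit_of_deg hb h)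
  have e : f = homogeneousComponent 1 a * homogeneousComponent 1 b := by
    have hsum := sum_homogeneousComponent a
    rw [show a.totalDegree + 1 = 2 by omega, Finset.sum_range_succ, Finset.sum_range_one,
      homogeneousComponent_zero] at hsum
    have h2 : homogeneousComponent 2 f = f := by
      rw [homogeneousComponent_of_mem (n := 2) hf, if_pos rfl]
    rw [← h2]
    conv_lhs => rw [hab, ← hsum, add_mul, map_add, homogeneousComponent_C_mul]
    rw [homogeneousComponent_eq_zero 2 b (by omega), mul_zero, zero_add]
    exact comp_mul (homogeneousComponent_isHomogeneous 1 a) 1 b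
  refine ⟨_, _, homogeneousComponent_isHomogeneous 1 a, homogeneousComponent_isHomogeneous 1 b, ?_, ?_, e⟩
  · intro h; rw [h, zero_mul] at e; exact h0 e
  · intro h; rw [h, mul_zero] at e; exact h0 e

lemma dichotomy (V : Submodule K (MvPolynomial (Fin n) K)) (hV : ∀ f ∈ V, f.IsHomogeneous 2)
    (hd : 2 ≤ Module.finrank K V) :
    (∃ f ∈ V, ∃ g ∈ V, f ≠ 0 ∧ IsRelPrime f g) ∨
      (∃ l : MvPolynomial (Fin n) K, l.IsHomogeneous 1 ∧ l ≠ 0 ∧ ∀ g ∈ V, l ∣ g) := by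
  have hne : V ≠ ⊥ := by rintro rfl; simp at hd
  obtain ⟨f, hf, hf0⟩ := Submodule.exists_mem_ne_zero_of_ne_bot hne
  by_cases hirr : Irreducible f
  · left
    have : ∃ g ∈ V, g ∉ Submodule.span K {f} := by
      by_contra hc
      push Not at hc
      have hle : V ≤ Submodule.span K {f} := hc
      have := Submodule.finrank_mono hle
      have := finrank_span_le_card (R := K) ({f} : Set (MvPolynomial (Fin n) K))
      simp at this
      omega
    obtain ⟨g, hg, hgf⟩ := this
    refine ⟨f, hf, g, hg, hf0, ?_⟩
    rw [hirr.isRelPrime_iff_not_dvd]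
    rintro ⟨k, hk⟩
    apply hgf
    have := congrArg (homogeneousComponent (0 + 2)) hk
    rw [comp_mul (hV f hf), homogeneousComponent_zero, homogeneousComponent_of_mem (n := 2) (hV g hg)] at this
    rw [Submodule.mem_span_singleton]
    refine ⟨coeff 0 k, ?_⟩
    rw [smul_eq_C_mul, mul_comm]
    simpa using this.symm
  · obtain ⟨a, b, ha, hb, ha0, hb0, rfl⟩ := quad_factor (hV f hf) hf0 hirr
    by_cases ca : ∀ g ∈ V, a ∣ g
    · exact Or.inr ⟨a, ha, ha0, ca⟩
    by_cases cb : ∀ g ∈ V, b ∣ g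
    · exact Or.inr ⟨b, hb, hb0, cb⟩
    left
    push Not at ca cb
    obtain ⟨g1, hg1, h1⟩ := ca
    obtain ⟨g2, hg2, h2⟩ := cb
    have : ∃ g ∈ V, ¬ a ∣ g ∧ ¬ b ∣ g := by
      by_cases c1 : b ∣ g1
      · by_cases c2 : a ∣ g2
        · refine ⟨g1 + g2, V.add_mem hg1 hg2, ?_, ?_⟩
          · intro h; exact h1 ((dvd_add_left c2).1 h)
          · intro h; exact h2 ((dvd_add_right c1).1 h)
        · exact ⟨g2, hg2, c2, h2⟩
      · exact ⟨g1, hg1, h1, c1⟩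
    obtain ⟨g, hg, hga, hgb⟩ := this
    refine ⟨a * b, hf, g, hg, hf0, ?_⟩
    exact IsRelPrime.mul_left ((lin_irred ha ha0).isRelPrime_iff_not_dvd.2 hga)
      ((lin_irred hb hb0).isRelPrime_iff_not_dvd.2 hgb)

/-- points on the hyperplane `l = 0` -/
lemma exists_point [Infinite K] {l g : MvPolynomial (Fin n) K} (hl : l.IsHomogeneous 1) (h0 : l ≠ 0)
    (hg : ¬ l ∣ g) : ∃ p, eval p l = 0 ∧ eval p g ≠ 0 := by
  obtain ⟨m, hm⟩ : ∃ m : Fin n → K, eval m l ≠ 0 := exists_eval_ne h0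
  let σ : MvPolynomial (Fin n) K →ₐ[K] MvPolynomial (Fin n) K :=
    aeval (fun k => X k - C (m k / eval m l) * l)
  have hσlin : ∀ x : MvPolynomial (Fin n) K, x.IsHomogeneous 1 → 
      σ x = x - C (eval m x / eval m l) * l := by
    refine hs_one_induction ?_ (by simp) ?_ ?_
    · intro k; simp [σ]
    · intro x y hx hy
      rw [map_add, hx, hy, map_add, add_div, map_add]; ring
    · intro c x hx
      rw [map_smul, hx, smul_eval, mul_div_assoc, map_mul, smul_sub, smul_eq_C_mul, smul_eq_C_mul]
      ring
  have hσl : σ l = 0 := by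
    rw [hσlin l hl, div_self hm, map_one]; ring
  have hσ : ∀ q, l ∣ q - σ q := by
    intro q
    induction q using MvPolynomial.induction_on with
    | C a => simp [σ]
    | add p q hp hq =>
      rw [map_add]
      have : p + q - (σ p + σ q) = (p - σ p) + (q - σ q) := by ring
      rw [this]; exact dvd_add hp hq
    | mul_X p k hp =>
      rw [map_mul, hσlin (X k) (isHomogeneous_X _ _)]
      have : p * X k - σ p * (X k - C (eval m (X k) / eval m l) * l)
        = (p - σ p) * X k + l * (σ p * C (eval m (X k) / eval m l)) := by ring
      rw [this]; exact dvd_add (hp.mul_right _) (dvd_mul_right _ _)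
  have hσg : σ g ≠ 0 := by
    intro h
    have := hσ g
    rw [h, sub_zero] at this
    exact hg this
  obtain ⟨p, hp⟩ := exists_eval_ne hσg
  have hev : ∀ q, eval p (σ q) = eval (fun k => eval p (X k - C (m k / eval m l) * l)) q := by
    intro q
    induction q using MvPolynomial.induction_on with
    | C a => simp [σ]
    | add p q hp hq => rw [map_add, map_add, map_add, hp, hq]
    | mul_X p k hp => rw [map_mul, map_mul, map_mul, hp]; simp [σ]
  refine ⟨fun k => eval p (X k - C (m k / eval m l) * l), ?_, ?_⟩
  · rw [← hev, hσl, map_zero]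
  · rwa [← hev]
end

section
variable {n : ℕ} {K : Type*} [Field K]

/-- `x ↦ l x` in `R/I` -/
def Ml (I : Ideal (MvPolynomial (Fin n) K)) (l : MvPolynomial (Fin n) K) :
    MvPolynomial (Fin n) K →ₗ[K] MvPolynomial (Fin n) K ⧸ I :=
  (Ideal.Quotient.mkₐ K I).toLinearMap ∘ₗ LinearMap.mulLeft K l

lemma Ml_apply (I : Ideal (MvPolynomial (Fin n) K)) (l x : MvPolynomial (Fin n) K) :
    Ml I l x = Ideal.Quotient.mk I l * Ideal.Quotient.mk I x :=
  map_mul (Ideal.Quotient.mk I) l x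

lemma map_Ml (I : Ideal (MvPolynomial (Fin n) K)) (l : MvPolynomial (Fin n) K) (i : ℕ) :
    (homogeneousSubmodule (Fin n) K i).map (Ml I l) = mg (Ideal.Quotient.mk I l) i := by
  ext y
  rw [mem_mg, Submodule.mem_map]
  constructor
  · rintro ⟨x, hx, rfl⟩
    exact ⟨_, mem_gr.2 ⟨x, hx, rfl⟩, (Ml_apply I l x).symm⟩
  · rintro ⟨y, hy, rfl⟩
    obtain ⟨x, hx, rfl⟩ := mem_gr.1 hy
    exact ⟨x, hx, Ml_apply I l x⟩

lemma Vl_finrank {I : Ideal (MvPolynomial (Fin n) K)} {l : MvPolynomial (Fin n) K}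
    (hl : l.IsHomogeneous 1) (h0 : l ≠ 0) {i : ℕ} (hd : ∀ g ∈ Ideg I (i+1), l ∣ g) :
    Module.finrank K (homogeneousSubmodule (Fin n) K i ⊓ LinearMap.ker (Ml I l) : 
      Submodule K (MvPolynomial (Fin n) K)) = Module.finrank K (Ideg I (i+1)) := by
  have e : (homogeneousSubmodule (Fin n) K i ⊓ LinearMap.ker (Ml I l)).map (LinearMap.mulLeft K l)
      = Ideg I (i+1) := by
    ext g
    rw [Submodule.mem_map]
    constructor
    · rintro ⟨x, ⟨hx, hx2⟩, rfl⟩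
      rw [mem_Ideg]
      refine ⟨?_, Ideal.Quotient.eq_zero_iff_mem.1 hx2⟩
      rw [add_comm]
      exact hl.mul hx
    · intro hg
      obtain ⟨x, hx⟩ := hd g hg
      obtain ⟨hgh, hgI⟩ := mem_Ideg.1 hg
      have h2 := congrArg (homogeneousComponent (i + 1)) hx
      rw [comp_mul hl, homogeneousComponent_of_mem (n := i+1) hgh, if_pos rfl] at h2
      refine ⟨homogeneousComponent i x, ⟨homogeneousComponent_mem _ _, ?_⟩, h2.symm⟩
      apply Ideal.Quotient.eq_zero_iff_mem.2
      rw [LinearMap.mulLeft_apply, ← h2]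
      exact hgI
  rw [← e]
  have hinj : Function.Injective (LinearMap.mulLeft K l) := fun x y h => mul_left_cancel₀ h0 h
  exact (Submodule.equivMapOfInjective _ hinj _).finrank_eq

lemma hilb_of_dvd {I : Ideal (MvPolynomial (Fin n) K)} {l : MvPolynomial (Fin n) K}
    (hl : l.IsHomogeneous 1) (h0 : l ≠ 0) {i : ℕ} (hd : ∀ g ∈ Ideg I (i+1), l ∣ g) :
    hilb n K I (i+1) + (n + i - 1).choose i = (n + (i + 1) - 1).choose (i+1) +
      Module.finrank K (mg (Ideal.Quotient.mk I l) i) := by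
  have h1 := hilb_add_Ideg I (i+1)
  have := hs_fin (n := n) (K := K) i
  have h2 := finrank_map_add_ker (Ml I l) (homogeneousSubmodule (Fin n) K i)
  rw [map_Ml, Vl_finrank hl h0 hd, finrank_hs] at h2
  omega

/-- if multiplication by `l` on `A_1` has rank one, find the dual point. -/
lemma dual_point {I : Ideal (MvPolynomial (Fin n) K)} {l : MvPolynomial (Fin n) K}
    (h : Module.finrank K (mg (Ideal.Quotient.mk I l) 1) = 1) :
    ∃ (q : Fin n → K) (y : MvPolynomial (Fin n) K ⧸ I), q ≠ 0 ∧ y ≠ 0 ∧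
      ∀ x : MvPolynomial (Fin n) K, x.IsHomogeneous 1 → Ml I l x = eval q x • y := by
  obtain ⟨⟨y, hy⟩, hy0, hspan⟩ := finrank_eq_one_iff'.1 h
  have hM : ∀ x : MvPolynomial (Fin n) K, x.IsHomogeneous 1 → ∃ c : K, Ml I l x = c • y := by
    intro x hx
    have : Ml I l x ∈ mg (Ideal.Quotient.mk I l) 1 := by
      rw [← map_Ml]; exact ⟨x, hx, rfl⟩
    obtain ⟨c, hc⟩ := hspan ⟨_, this⟩
    exact ⟨c, (congrArg Subtype.val hc).symm⟩
  choose q hq using fun k : Fin n => hM (X k) (isHomogeneous_X _ _)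
  have hlin : ∀ x : MvPolynomial (Fin n) K, x.IsHomogeneous 1 → Ml I l x = eval q x • y := by
    refine hs_one_induction ?_ (by simp) ?_ ?_
    · intro k; rw [hq, eval_X]
    · intro x z hx hz; rw [map_add, map_add, hx, hz, add_smul]
    · intro c x hx; rw [map_smul, hx, smul_eval, mul_smul]
  have hy0' : y ≠ 0 := fun h => hy0 (Subtype.ext h)
  refine ⟨q, y, ?_, hy0', hlin⟩
  rintro rfl
  rw [← map_Ml] at hy
  obtain ⟨x, hx, rfl⟩ := hy
  apply hy0'
  rw [hlin x hx, eval_zero_of_hom le_rfl hx, zero_smul]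

lemma mg_rank_one {I : Ideal (MvPolynomial (Fin n) K)} {j : ℕ} (hA : IsAG n K I j)
    {l : MvPolynomial (Fin n) K} (hl : l.IsHomogeneous 1) (hlI : l ∉ I)
    (h : Module.finrank K (mg (Ideal.Quotient.mk I l) 1) = 1) (i : ℕ) (hi : 1 ≤ i) (hij : i < j) :
    Module.finrank K (mg (Ideal.Quotient.mk I l) i) = 1 := by
  apply le_antisymm
  · obtain ⟨q, y, hq, hy, hqy⟩ := dual_point h
    obtain ⟨k, hk⟩ : ∃ k, q k ≠ 0 := by
      by_contra hc; push Not at hc; exact hq (funext hc)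
    clear hij
    induction i, hi using Nat.le_induction with
    | base => exact h.le
    | succ i hi ih =>
      have : mg (Ideal.Quotient.mk I l) (i+1) ≤ (mg (Ideal.Quotient.mk I l) i).map
          (LinearMap.mulLeft K (Ideal.Quotient.mk I (X k))) := by
        intro z hz
        obtain ⟨a, ha, rfl⟩ := mem_mg.1 hz
        rw [gr_succ] at ha
        refine Submodule.mul_induction_on ha ?_ ?_
        · intro m hm a ha
          obtain ⟨x, hx, rfl⟩ := mem_gr.1 hm
          refine ⟨(eval q x / q k) • (Ideal.Quotient.mk I l * a), 
            Submodule.smul_mem _ _ (mem_mg.2 ⟨a, ha, rfl⟩), ?_⟩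
          have e1 := hqy x hx
          have e2 := hqy (X k) (isHomogeneous_X _ _)
          rw [Ml_apply] at e1 e2
          rw [LinearMap.mulLeft_apply, ← mul_assoc, e1, mul_smul_comm, ← mul_assoc, 
            mul_comm (Ideal.Quotient.mk I (X k)), e2, eval_X, smul_mul_assoc, smul_mul_assoc, smul_smul,
            div_mul_cancel₀ _ hk]
        · intro a b ha hb
          rw [mul_add]; exact Submodule.add_mem _ ha hb
      have f1 := mg_fin (Ideal.Quotient.mk I l) i
      have f2 : Module.Finite K ((mg (Ideal.Quotient.mk I l) i).map
          (LinearMap.mulLeft K (Ideal.Quotient.mk I (X k)))) := Module.Finite.map _ _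
      exact ((Submodule.finrank_mono this).trans (Submodule.finrank_map_le _ _)).trans ih
  · rw [Nat.one_le_iff_ne_zero]
    intro h0
    have := mg_fin (Ideal.Quotient.mk I l) i
    rw [Submodule.finrank_eq_zero] at h0
    obtain ⟨b, hb, hb0⟩ := nondeg hA (j-1) 1 (by omega) (Ideal.Quotient.mk I l)
      (mem_gr.2 ⟨l, hl, rfl⟩) (fun h => hlI (Ideal.Quotient.eq_zero_iff_mem.1 h))
    apply hb0
    have e : j - 1 = i + (j - 1 - i) := by omega
    rw [e, gr_add] at hb
    refine Submodule.mul_induction_on hb ?_ ?_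
    · intro m hm c _
      have : Ideal.Quotient.mk I l * m ∈ mg (Ideal.Quotient.mk I l) i := mem_mg.2 ⟨m, hm, rfl⟩
      rw [h0, Submodule.mem_bot] at this
      rw [← mul_assoc, this, zero_mul]
    · intro x y hx hy; rw [mul_add, hx, hy, add_zero]

lemma exists_third {l : MvPolynomial (Fin 4) K} [Infinite K] (hl : l.IsHomogeneous 1) (h0 : l ≠ 0)
    {p q : Fin 4 → K} (hpl : eval p l = 0) (hpq : LinearIndependent K ![p, q]) :
    ∃ m, eval m l ≠ 0 ∧ LinearIndependent K ![m, p, q] := by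
  have hadd : ∀ (x y : Fin 4 → K), eval (x + y) l = eval x l + eval y l := by
    intro x y
    refine hs_one_induction (P := fun l => eval (x + y) l = eval x l + eval y l) 
      ?_ (by simp) ?_ ?_ l hl
    · intro k; simp
    · intro a b ha hb; simp only [map_add, ha, hb]; ring
    · intro c a ha; simp only [smul_eval, ha]; ring
  obtain ⟨m, hm⟩ := exists_linearIndependent_cons_of_lt_finrank hpq (by simp)
  by_cases c1 : eval m l ≠ 0
  · exact ⟨m, c1, hm⟩
  push Not at c1
  by_cases c2 : eval q l ≠ 0
  · refine ⟨m + q, by rw [hadd, c1, zero_add]; exact c2, ?_⟩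
    rw [linearIndependent_finCons] at hm
    change LinearIndependent K (Fin.cons (m+q) ![p, q] : Fin 3 → _)
    rw [linearIndependent_finCons]
    refine ⟨hpq, fun h => hm.2 ?_⟩
    have := Submodule.sub_mem _ h (Submodule.subset_span (s := Set.range ![p, q]) ⟨1, rfl⟩)
    simpa using this
  push Not at c2
  obtain ⟨m, hm⟩ := exists_eval_ne h0
  refine ⟨m, hm, ?_⟩
  change LinearIndependent K (Fin.cons m ![p, q] : Fin 3 → _)
  rw [linearIndependent_finCons]
  refine ⟨hpq, fun h => hm ?_⟩
  have e : Set.range ![p, q] = {p, q} := by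
    rw [Matrix.range_cons, Matrix.range_cons, Matrix.range_empty, Set.union_empty]; rfl
  rw [e, Submodule.mem_span_pair] at h
  obtain ⟨a, b, rfl⟩ := h
  rw [hadd, lin_smul _ _ _ hl, lin_smul _ _ _ hl, hpl, c2]; ring

set_option maxHeartbeats 1000000 in
theorem caseB [CharZero K] {I : Ideal (MvPolynomial (Fin 4) K)} {j : ℕ} (hj : 4 ≤ j) (hA : IsAG 4 K I j)
    (hsym : ∀ i ≤ j, hilb 4 K I (j - i) = hilb 4 K I i)
    (h0 : hilb 4 K I 0 = 1) (h1 : hilb 4 K I 1 = 4) (h2 : hilb 4 K I 2 = 7)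
    {l : MvPolynomial (Fin 4) K} (hl : l.IsHomogeneous 1) (hl0 : l ≠ 0)
    (hd2 : ∀ g ∈ Ideg I 2, l ∣ g) :
    DeltaOSeq (hilb 4 K I) (j / 2) := by
  classical
  have hlow : ∀ i, hilb 4 K I i = (4 + i - 1).choose i → Ideg I i = ⊥ := by
    intro i hi
    have := hilb_add_Ideg I i
    have := Ideg_fin I i
    exact Submodule.finrank_eq_zero.1 (by omega)
  have b0 := hlow 0 (by rw [h0]; rfl)
  have b1 := hlow 1 (by rw [h1]; rfl)
  have hlI : l ∉ I := by
    intro h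
    have : l ∈ Ideg I 1 := mem_Ideg.2 ⟨hl, h⟩
    rw [b1] at this
    exact hl0 (by simpa using this)
  have hr1 : Module.finrank K (mg (Ideal.Quotient.mk I l) 1) = 1 := by
    have := hilb_of_dvd hl hl0 (i := 1) hd2
    have e1 : (4 + 1 - 1).choose 1 = 4 := rfl
    have e2 : (4 + (1 + 1) - 1).choose (1 + 1) = 10 := rfl
    rw [e1, e2] at this
    simp only [Nat.reduceAdd] at this
    omega
  have hrank := mg_rank_one hA hl hlI hr1
  have hj1 : ¬ ∀ g ∈ Ideg I (j+1), l ∣ g := by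
    intro h
    have := hilb_of_dvd hl hl0 h
    rw [hA.2.2.2.2 (j+1) (by omega)] at this
    have e : (4 + (j+1) - 1) = (4 + j - 1) + 1 := by omega
    rw [e, Nat.choose_succ_succ] at this
    have : 0 < (4 + j - 1).choose (j+1) := Nat.choose_pos (by omega)
    simp only [Nat.succ_eq_add_one] at *
    omega
  have hex : ∃ t, ¬ ∀ g ∈ Ideg I t, l ∣ g := ⟨_, hj1⟩
  obtain ⟨t, ht, hmin⟩ : ∃ t, (¬ ∀ g ∈ Ideg I t, l ∣ g) ∧ ∀ i < t, ∀ g ∈ Ideg I i, l ∣ g :=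
    ⟨Nat.find hex, Nat.find_spec hex, fun i hi => by
      have := Nat.find_min hex hi
      rwa [not_not] at this⟩
  have ht3 : 3 ≤ t := by
    by_contra hc
    have : t = 0 ∨ t = 1 ∨ t = 2 := by omega
    rcases this with rfl | rfl | rfl
    · apply ht; rw [b0]; intro g hg; rw [(Submodule.mem_bot K).1 hg]; exact dvd_zero _
    · apply ht; rw [b1]; intro g hg; rw [(Submodule.mem_bot K).1 hg]; exact dvd_zero _
    · exact ht hd2
  have htj : t ≤ j + 1 := by
    by_contra hc
    exact hj1 (hmin (j+1) (by omega))
  have hh : ∀ i, 1 ≤ i → i < t → hilb 4 K I i = (3 + i - 1).choose i + 1 := by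
    intro i hi1 hi2
    obtain ⟨k, rfl⟩ : ∃ k, i = k + 1 := ⟨i - 1, by omega⟩
    rcases Nat.eq_zero_or_pos k with rfl | hk
    · rw [h1]; rfl
    · have e := hilb_of_dvd hl hl0 (hmin (k+1) hi2)
      rw [hrank k hk (by omega)] at e
      have e1 : 4 + (k+1) - 1 = (4 + k - 1) + 1 := by omega
      have e2 : 3 + (k+1) - 1 = 4 + k - 1 := by omega
      rw [e1, Nat.choose_succ_succ] at e
      rw [e2]
      simp only [Nat.succ_eq_add_one] at e
      omega
  push Not at ht
  obtain ⟨f, hf, hlf⟩ := ht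
  obtain ⟨hfh, hfI⟩ := mem_Ideg.1 hf
  obtain ⟨q, y, hq0, hy0, hqy⟩ := dual_point hr1
  obtain ⟨u', hu'1, hu'2, hu'3⟩ : ∃ u' : MvPolynomial (Fin 4) K, u'.IsHomogeneous 1 ∧
      Ml I l u' = 0 ∧ ¬ l ∣ u' := by
    by_contra hc
    push Not at hc
    have e1 := Vl_finrank (I := I) hl hl0 (i := 1) hd2
    have e2 := hilb_add_Ideg I 2
    have e3 : (4 + 2 - 1).choose 2 = 10 := rfl
    rw [e3, h2] at e2
    simp only [Nat.reduceAdd] at e1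
    have hle : (homogeneousSubmodule (Fin 4) K 1 ⊓ LinearMap.ker (Ml I l) :
        Submodule K (MvPolynomial (Fin 4) K)) ≤ Submodule.span K {l} := by
      rintro x ⟨hx1, hx2⟩
      obtain ⟨a, ha⟩ := hc x hx1 hx2
      have h2 := congrArg (homogeneousComponent (0 + 1)) ha
      rw [comp_mul hl, homogeneousComponent_of_mem (n := 0+1) hx1, if_pos rfl,
        homogeneousComponent_zero] at h2
      rw [Submodule.mem_span_singleton]
      exact ⟨coeff 0 a, by rw [h2, smul_eq_C_mul, mul_comm]⟩
    have e4 := Submodule.finrank_mono hle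
    have e5 := finrank_span_le_card (R := K) ({l} : Set (MvPolynomial (Fin 4) K))
    simp only [Set.toFinset_singleton, Finset.card_singleton] at e5
    omega
  have huq : eval q u' = 0 := by
    have := hqy u' hu'1
    rw [hu'2] at this
    rcases smul_eq_zero.1 this.symm with h | h
    · exact h
    · exact absurd h hy0
  have hfu : ¬ l ∣ f * u' := by
    intro h
    rcases (lin_irred hl hl0).prime.dvd_or_dvd h with h | h
    · exact hlf h
    · exact hu'3 h
  obtain ⟨p, hpl, hpfu⟩ := exists_point hl hl0 hfu
  rw [map_mul] at hpfu
  have hpf : eval p f ≠ 0 := left_ne_zero_of_mul hpfu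
  have hpu : eval p u' ≠ 0 := right_ne_zero_of_mul hpfu
  have hp0 : p ≠ 0 := by
    rintro rfl
    exact hpu (eval_zero_of_hom le_rfl hu'1)
  have li2 : LinearIndependent K ![p, q] := by
    rw [LinearIndependent.pair_iff' hp0]
    rintro a rfl
    rw [lin_smul _ _ _ hu'1] at huq
    rcases mul_eq_zero.1 huq with h | h
    · exact hq0 (by rw [h, zero_smul])
    · exact hpu h
  obtain ⟨m, hml, li3⟩ := exists_third hl hl0 hpl li2
  obtain ⟨z, li4⟩ := exists_linearIndependent_cons_of_lt_finrank li3 (by simp)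
  obtain ⟨b, hb⟩ := basis_of_li _ li4
  obtain ⟨s, hs1, hs2, hs3⟩ := dual_forms b
  have eb1 : b 1 = m := by rw [hb]; rfl
  have eb2 : b 2 = p := by rw [hb]; rfl
  have eb3 : b 3 = q := by rw [hb]; rfl
  have hls : ∀ k : Fin 4, k ≠ 3 → l * s k ∈ I := by
    intro k hk
    have e := hqy (s k) (hs1 k)
    rw [← eb3, hs3, if_neg (Ne.symm hk), zero_smul] at e
    exact Ideal.Quotient.eq_zero_iff_mem.1 e
  obtain ⟨k, rfl⟩ : ∃ k, t = k + 2 := ⟨t - 2, by omega⟩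
  refine delta_of_gen hA hsym h0 (Or.inr h1) (k+1) (by omega) ?_
    (mem_gr.2 ⟨_, hs1 0, rfl⟩) (mem_gr.2 ⟨_, hs1 3, rfl⟩) (gen_of_quot hA.1 (hs1 0) (hs1 3) _ ?_)
  · intro i hi1 hi2
    rw [hh i (by omega) (by omega), hh (i-1) (by omega) (by omega), choose_step i hi1]
    omega
  · intro g hg
    set J := I ⊔ Ideal.span {s 0, s 3} with hJ
    have z0 : Ideal.Quotient.mk J (s 0) = 0 := Ideal.Quotient.eq_zero_iff_mem.2
      (Ideal.mem_sup_right (Ideal.subset_span (by simp)))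
    have z3 : Ideal.Quotient.mk J (s 3) = 0 := Ideal.Quotient.eq_zero_iff_mem.2
      (Ideal.mem_sup_right (Ideal.subset_span (by simp)))
    have hφ1 : ∀ x : MvPolynomial (Fin 4) K, x.IsHomogeneous 1 → Ideal.Quotient.mkₐ K J x =
        eval p x • Ideal.Quotient.mk J (s 2) + eval m x • Ideal.Quotient.mk J (s 1) := by
      intro x hx
      conv_lhs => rw [hs2 x hx]
      rw [map_sum, Fin.sum_univ_four, map_smul, map_smul, map_smul, map_smul, eb1, eb2]
      change _ • Ideal.Quotient.mk J (s 0) + _ • Ideal.Quotient.mk J (s 1) +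
        _ • Ideal.Quotient.mk J (s 2) + _ • Ideal.Quotient.mk J (s 3) = _
      rw [z0, z3, smul_zero, smul_zero, zero_add, add_zero, add_comm]
    have hkill : ∀ k : Fin 4, k ≠ 3 → Ideal.Quotient.mk J (s 1) * Ideal.Quotient.mk J (s k) = 0 := by
      intro k hk
      have e1 := hφ1 l hl
      rw [hpl, zero_smul, zero_add] at e1
      have e2 : Ideal.Quotient.mk J (l * s k) = 0 :=
        Ideal.Quotient.eq_zero_iff_mem.2 (Ideal.mem_sup_left (hls k hk))
      rw [map_mul] at e2
      change Ideal.Quotient.mk J l = _ at e1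
      rw [e1, smul_mul_assoc] at e2
      rcases smul_eq_zero.1 e2 with h | h
      · exact absurd h hml
      · exact h
    have hφ := power_kill (Ideal.Quotient.mkₐ K J) p m (Ideal.Quotient.mk J (s 2))
      (Ideal.Quotient.mk J (s 1)) hφ1 (by rw [mul_comm]; exact hkill 2 (by decide))
      (hkill 1 (by decide)) k
    have e1 := hφ f hfh
    have e2 := hφ g hg
    have : (Ideal.Quotient.mkₐ K J) f = 0 :=
      Ideal.Quotient.eq_zero_iff_mem.2 (Ideal.mem_sup_left hfI)
    rw [this] at e1
    rcases smul_eq_zero.1 e1.symm with h | h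
    · exact absurd h hpf
    · rw [h, smul_zero] at e2
      exact Ideal.Quotient.eq_zero_iff_mem.1 e2
end

lemma delta4 {K : Type*} [Field K] [CharZero K] {I : Ideal (MvPolynomial (Fin 4) K)} {j : ℕ}
    (hj : 4 ≤ j) (hA : IsAG 4 K I j)
    (hsym : ∀ i ≤ j, hilb 4 K I (j - i) = hilb 4 K I i)
    (h0 : hilb 4 K I 0 = 1) (h1 : hilb 4 K I 1 = 4) (h2 : hilb 4 K I 2 = 7) :
    DeltaOSeq (hilb 4 K I) (j / 2) := by
  have e2 := hilb_add_Ideg I 2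
  have e3 : (4 + 2 - 1).choose 2 = 10 := rfl
  rw [e3, h2] at e2
  rcases dichotomy (Ideg I 2) (fun f hf => (mem_Ideg.1 hf).1) (by omega) with
    ⟨f, hf, g, hg, hf0, hfg⟩ | ⟨l, hl, hl0, hd⟩
  · obtain ⟨L, u, hL, hu, h⟩ := caseA (mem_Ideg.1 hf).1 (mem_Ideg.1 hg).1 hf0 hfg
      (mem_Ideg.1 hf).2 (mem_Ideg.1 hg).2
    refine delta_of_gen hA hsym h0 (Or.inr h1) 2 le_rfl ?_
      (mem_gr.2 ⟨_, hL, rfl⟩) (mem_gr.2 ⟨_, hu, rfl⟩) (gen_of_quot hA.1 hL hu _ h)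
    intro i hi1 hi2
    obtain rfl : i = 2 := by omega
    rw [h2, h1]
  · exact caseB hj hA hsym h0 h1 h2 hl hl0 hd

lemma delta_congr {h g : ℕ → ℕ} {m : ℕ} (e : ∀ i ≤ m, h i = g i) (H : DeltaOSeq h m) :
    DeltaOSeq g m := by
  obtain ⟨H1, H2, H3⟩ := H
  refine ⟨fun i hi1 hi2 => ?_, rfl, fun i hi1 hi2 => ?_⟩
  · rw [← e i hi2, ← e (i-1) (by omega)]; exact H1 i hi1 hi2
  · have := H3 i hi1 hi2
    simp only [Nat.add_eq_zero_iff, one_ne_zero, and_false, if_false, Nat.add_sub_cancel,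
      if_neg (show i ≠ 0 by omega)] at this ⊢
    rw [← e i (by omega), ← e (i-1) (by omega), ← e (i+1) hi2]
    exact this

lemma delta_shift {h g : ℕ → ℕ} {m : ℕ} (h0 : h 0 = 1) (h1 : h 1 = 4) (h2 : h 2 = 7)
    (e : ∀ i, 1 ≤ i → i ≤ m → h i = g i + 1) (H : DeltaOSeq g m) :
    DeltaOSeq h m := by
  obtain ⟨H1, H2, H3⟩ := H
  refine ⟨fun i hi1 hi2 => ?_, rfl, fun i hi1 hi2 => ?_⟩
  · rcases Nat.eq_or_lt_of_le hi1 with rfl | hi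
    · simp [h0, h1]
    · rw [e i hi1 hi2, e (i-1) (by omega) (by omega)]
      have := H1 i hi1 hi2
      omega
  · have := H3 i hi1 hi2
    simp only [Nat.add_eq_zero_iff, one_ne_zero, and_false, if_false, Nat.add_sub_cancel,
      if_neg (show i ≠ 0 by omega)] at this ⊢
    rcases Nat.eq_or_lt_of_le hi1 with rfl | hi
    · simp only [Nat.reduceAdd, Nat.sub_self, h0, h1, h2]
      exact le_macB 0 3
    · rw [e i (by omega) (by omega), e (i-1) (by omega) (by omega), e (i+1) (by omega) hi2,
        Nat.add_sub_add_right, Nat.add_sub_add_right]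
      exact this

/-- Let `j ≥ 4` and let `H = (h_0,...,h_j)` be a symmetric
sequence of positive integers with `h_0 = 1`, `h_1 = 4`, `h_2 = 7`.  The
following are equivalent: (i) `H` is a Gorenstein sequence (the Hilbert
function of a graded Artinian Gorenstein quotient of `K[w,x,y,z]`);
(ii) `ΔH_{≤ j/2}` is an O-sequence; (iii) `H' = (1, h_1 - 1, ..., h_{j-1} - 1, 1)`
is a height three Gorenstein sequence. -/
theorem statement_17 {K : Type*} [Field K] [IsAlgClosed K] [CharZero K]
    (j : ℕ) (hj : 4 ≤ j) (h : ℕ → ℕ)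
    (hpos : ∀ i ≤ j, 0 < h i) (hsym : ∀ i ≤ j, h (j - i) = h i)
    (h0 : h 0 = 1) (h1 : h 1 = 4) (h2 : h 2 = 7) :
    ((∃ I : Ideal (MvPolynomial (Fin 4) K), IsAG 4 K I j ∧
        ∀ i ≤ j, hilb 4 K I i = h i) ↔
      DeltaOSeq h (j / 2)) ∧
    ((∃ I : Ideal (MvPolynomial (Fin 4) K), IsAG 4 K I j ∧
        ∀ i ≤ j, hilb 4 K I i = h i) ↔
      (∃ I' : Ideal (MvPolynomial (Fin 3) K), IsAG 3 K I' j ∧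
        hilb 3 K I' 0 = 1 ∧ hilb 3 K I' j = 1 ∧
        ∀ i, 1 ≤ i → i ≤ j - 1 → hilb 3 K I' i = h i - 1)) := by
  have key : (∃ I : Ideal (MvPolynomial (Fin 4) K), IsAG 4 K I j ∧
        ∀ i ≤ j, hilb 4 K I i = h i) → DeltaOSeq h (j / 2) := by
    rintro ⟨I, hA, hI⟩
    refine delta_congr (fun i hi => hI i (by omega)) (delta4 hj hA ?_ ?_ ?_ ?_)
    · intro i hi; rw [hI _ (by omega), hI i hi, hsym i hi]
    · rw [hI 0 (by omega), h0]
    · rw [hI 1 (by omega), h1]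
    · rw [hI 2 (by omega), h2]
  have key3 : (∃ I' : Ideal (MvPolynomial (Fin 3) K), IsAG 3 K I' j ∧
        hilb 3 K I' 0 = 1 ∧ hilb 3 K I' j = 1 ∧
        ∀ i, 1 ≤ i → i ≤ j - 1 → hilb 3 K I' i = h i - 1) → DeltaOSeq h (j / 2) := by
    rintro ⟨I, hA, e0, ej, hI⟩
    refine delta_shift h0 h1 h2 (g := hilb 3 K I) ?_ (delta3 hA ?_ e0 ?_ ?_)
    · intro i hi1 hi2
      have := hpos i (by omega)
      rw [hI i hi1 (by omega)]; omega
    · intro i hi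
      rcases Nat.eq_zero_or_pos i with rfl | hi0
      · rw [Nat.sub_zero, e0, ej]
      rcases Nat.eq_or_lt_of_le hi with rfl | hi'
      · rw [Nat.sub_self, e0, ej]
      · rw [hI i hi0 (by omega), hI (j-i) (by omega) (by omega), hsym i hi]
    · rw [hI 1 le_rfl (by omega), h1]
    · rw [hI 2 (by omega) (by omega), h2]
  have con := construct (K := K) j hj h hsym h0 h1 h2
  exact ⟨⟨key, fun H => (con H).1⟩, ⟨fun H => (con (key H)).2, fun H => (con (key3 H)).1⟩⟩

end
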